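/- arXiv:1502.07611 — 7 statements merged into one kernel-verified Lean document; each statement's English description precedes it below -/
import Mathlib

section
/- Let C(n) be the reduced cellular chain complex of the C₂-sphere of the n-fold regular representation (defined in the context), and let C(n)^{C₂} denote its fixed-point subcomplex, whose i-th term is the subgroup of γ-fixed elements of C(n)_i. Then: H_i(C(n)^{C₂}) ≅ ℤ/2 for every i with n ≤ i < 2n and i ≡ n (mod 2); H_{2n}(C(n)^{C₂}) is infinite cyclic if n is even and is 0 if n is odd; and H_i(C(n)^{C₂}) = 0 for all other i. -/
/-!
Statement 1: the homology of the fixed-point subcomplex `C(n)^{C₂}` of the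
reduced cellular chain complex `C(n)` of the C₂-sphere `S^{nρ₂}`.

We realize `ℤ[C₂]` as `ℤ × ℤ`, with the generator `γ` of `C₂` acting by the
swap `gam`; the γ-fixed subgroup is the diagonal `diag`, which is also the
copy of `ℤ` with trivial action sitting in degree `n` of the complex.
-/

namespace Stmt1

/-- The generator γ of C₂ acting on ℤ[C₂] ≅ ℤ × ℤ (swap of the basis). -/
def gam : (ℤ × ℤ) →ₗ[ℤ] (ℤ × ℤ) := (LinearMap.snd ℤ ℤ ℤ).prod (LinearMap.fst ℤ ℤ ℤ)

/-- The γ-fixed subgroup of ℤ[C₂]: the diagonal.  It is also the copy of ℤ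
with trivial γ-action (the degree-`n` chain group). -/
def diag : AddSubgroup (ℤ × ℤ) := (LinearMap.ker (gam - LinearMap.id)).toAddSubgroup

/-- The chain groups of `C(n)`: `ℤ` in degree `n`, `ℤ[C₂]` in degrees
`n < i ≤ 2n`, and `0` elsewhere. -/
def M (n : ℕ) (i : ℤ) : AddSubgroup (ℤ × ℤ) :=
  if i = (n : ℤ) then diag
  else if (n : ℤ) < i ∧ i ≤ 2 * (n : ℤ) then ⊤
  else ⊥

/-- The differentials of `C(n)` (as endomorphisms of the ambient `ℤ × ℤ`):
multiplication by `1 - (-1)^{i-n}γ` for `n < i ≤ 2n` (in degree `n + 1`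
this is the fold map onto the diagonal copy of `ℤ`), and `0` elsewhere. -/
def d (n : ℕ) (i : ℤ) : (ℤ × ℤ) →ₗ[ℤ] (ℤ × ℤ) :=
  if (n : ℤ) < i ∧ i ≤ 2 * (n : ℤ) then
    (if Even (i - (n : ℤ)) then LinearMap.id - gam else LinearMap.id + gam)
  else 0

/-- the chain groups of the fixed-point subcomplex `C(n)^{C₂}`:
the γ-fixed elements of `C(n)_i` -/
def MF (n : ℕ) (i : ℤ) : AddSubgroup (ℤ × ℤ) := M n i ⊓ diag

/-- cycles of `C(n)^{C₂}` in degree `i` -/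
def ZF (n : ℕ) (i : ℤ) : AddSubgroup (ℤ × ℤ) :=
  MF n i ⊓ (LinearMap.ker (d n i)).toAddSubgroup

/-- boundaries of `C(n)^{C₂}` in degree `i` -/
def BF (n : ℕ) (i : ℤ) : AddSubgroup (ℤ × ℤ) :=
  (MF n (i + 1)).map (d n (i + 1)).toAddMonoidHom

/-- homology of `C(n)^{C₂}` in degree `i` -/
abbrev HF (n : ℕ) (i : ℤ) := ZF n i ⧸ (BF n i).addSubgroupOf (ZF n i)

theorem mem_diag (x : ℤ × ℤ) : x ∈ diag ↔ x.1 = x.2 := by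
  obtain ⟨a, b⟩ := x
  simp [diag, gam, LinearMap.mem_ker, sub_eq_zero]
  omega

theorem mem_MF (n : ℕ) (i : ℤ) (x : ℤ × ℤ) :
    x ∈ MF n i ↔ x.1 = x.2 ∧ (((n : ℤ) ≤ i ∧ i ≤ 2 * (n : ℤ)) ∨ x.1 = 0) := by
  obtain ⟨a, b⟩ := x
  unfold MF M
  rw [AddSubgroup.mem_inf, mem_diag]
  split_ifs with h1 h2
  · rw [mem_diag]
    simp only
    omega
  · simp only [AddSubgroup.mem_top, true_and]
    omega
  · simp only [AddSubgroup.mem_bot, Prod.mk_eq_zero]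
    omega

theorem d_diag (n : ℕ) (i : ℤ) (a : ℤ) :
    d n i (a, a) = if ((n : ℤ) < i ∧ i ≤ 2 * (n : ℤ)) ∧ ¬ Even (i - (n : ℤ))
      then (2 * a, 2 * a) else 0 := by
  unfold d gam
  by_cases h1 : (n : ℤ) < i ∧ i ≤ 2 * (n : ℤ)
  · by_cases h2 : Even (i - (n : ℤ))
    · simp only [h1, h2, if_true, not_true, and_false, if_false]
      simp
    · simp only [h1, h2, if_true, if_false, not_false_eq_true, and_self]
      simp [two_mul]
  · simp only [h1, if_false, false_and]
    simp

theorem mem_ZF (n : ℕ) (i : ℤ) (x : ℤ × ℤ) :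
    x ∈ ZF n i ↔ x.1 = x.2 ∧
      (((n : ℤ) ≤ i ∧ i ≤ 2 * (n : ℤ) ∧ Even (i - (n : ℤ))) ∨ x.1 = 0) := by
  obtain ⟨a, b⟩ := x
  unfold ZF
  rw [AddSubgroup.mem_inf, mem_MF, Submodule.mem_toAddSubgroup, LinearMap.mem_ker]
  by_cases hab : a = b
  · subst hab
    rw [d_diag]
    split_ifs with h
    · simp only [Prod.mk_eq_zero, Int.even_iff, true_and] at *
      omega
    · simp only [Int.even_iff] at *
      simp only [true_and, and_true]
      omega
  · simp [hab]

theorem mem_BF (n : ℕ) (i : ℤ) (x : ℤ × ℤ) :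
    x ∈ BF n i ↔ x.1 = x.2 ∧ (((n : ℤ) ≤ i ∧ i < 2 * (n : ℤ) ∧ Even (i - (n : ℤ)) ∧ Even x.1)
      ∨ x.1 = 0) := by
  obtain ⟨a, b⟩ := x
  unfold BF
  rw [AddSubgroup.mem_map]
  constructor
  · rintro ⟨⟨u, v⟩, h1, h2⟩
    rw [mem_MF] at h1
    obtain ⟨huv, h1⟩ := h1
    simp only at huv
    subst huv
    change d n (i + 1) (u, u) = (a, b) at h2
    rw [d_diag] at h2
    split_ifs at h2 with h
    · simp only [Prod.mk.injEq, Int.even_iff] at *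
      omega
    · have := congrArg Prod.fst h2
      have := congrArg Prod.snd h2
      simp at *
      omega
  · rintro ⟨hab, h⟩
    simp only at hab
    subst hab
    simp only at h
    rcases h with ⟨h1, h2, h3, c, hc⟩ | h
    · refine ⟨(c, c), ?_, ?_⟩
      · rw [mem_MF]
        exact ⟨rfl, Or.inl (by omega)⟩
      · change d n (i + 1) (c, c) = _
        rw [d_diag, if_pos]
        · rw [hc, two_mul]
        · simp only [Int.even_iff] at *
          omega
    · subst h
      exact ⟨0, zero_mem _, map_zero _⟩

theorem HF_zero (n : ℕ) (i : ℤ) (h : ¬ ((n : ℤ) ≤ i ∧ i ≤ 2 * (n : ℤ) ∧ Even (i - (n : ℤ))))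
    (x : HF n i) : x = 0 := by
  induction x using QuotientAddGroup.induction_on with
  | H z =>
    rw [QuotientAddGroup.eq_zero_iff, AddSubgroup.mem_addSubgroupOf, mem_BF]
    have := (mem_ZF n i z).1 z.2
    exact ⟨this.1, Or.inr (this.2.resolve_left h)⟩

/-- first coordinate on cycles -/
def pr (n : ℕ) (i : ℤ) : ZF n i →+ ℤ := (AddMonoidHom.fst ℤ ℤ).comp (ZF n i).subtype

theorem pr_surj (n : ℕ) (i : ℤ) (h : (n : ℤ) ≤ i ∧ i ≤ 2 * (n : ℤ) ∧ Even (i - (n : ℤ))) :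
    Function.Surjective (pr n i) := fun a =>
  ⟨⟨(a, a), (mem_ZF n i _).2 ⟨rfl, Or.inl h⟩⟩, rfl⟩

theorem HF_equiv {A : Type} [AddCommGroup A] (n : ℕ) (i : ℤ) (f : ZF n i →+ A)
    (hf : Function.Surjective f) (hk : ∀ z : ZF n i, (z : ℤ × ℤ) ∈ BF n i ↔ f z = 0) :
    Nonempty (HF n i ≃+ A) := by
  have e : (BF n i).addSubgroupOf (ZF n i) = f.ker := by
    ext z
    rw [AddSubgroup.mem_addSubgroupOf, AddMonoidHom.mem_ker, hk]
  exact ⟨(QuotientAddGroup.quotientAddEquivOfEq e).trans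
    (QuotientAddGroup.quotientKerEquivOfSurjective f hf)⟩

/-- The homology of the fixed-point subcomplex `C(n)^{C₂}`:
`ℤ/2` in degrees `n ≤ i < 2n` with `i ≡ n (mod 2)`; in degree `2n` it is
infinite cyclic for `n` even and `0` for `n` odd; and `0` in all other
degrees. -/
theorem statement1 (n : ℕ) (hn : 1 ≤ n) :
    (∀ i : ℤ, (n : ℤ) ≤ i → i < 2 * (n : ℤ) → Even (i - (n : ℤ)) →
      Nonempty (HF n i ≃+ ZMod 2)) ∧
    (Even n → Nonempty (HF n (2 * (n : ℤ)) ≃+ ℤ)) ∧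
    (¬ Even n → ∀ x : HF n (2 * (n : ℤ)), x = 0) ∧
    (∀ i : ℤ, i ≠ 2 * (n : ℤ) →
      ¬ ((n : ℤ) ≤ i ∧ i < 2 * (n : ℤ) ∧ Even (i - (n : ℤ))) →
      ∀ x : HF n i, x = 0) := by
  refine ⟨fun i h1 h2 h3 => ?_, fun h => ?_, fun h => ?_, fun i h1 h2 => ?_⟩
  · refine HF_equiv n i ((Int.castAddHom (ZMod 2)).comp (pr n i))
      ((ZMod.intCast_surjective).comp (pr_surj n i ⟨h1, h2.le, h3⟩)) fun z => ?_
    have hz := ((mem_ZF n i z).1 z.2).1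
    change _ ↔ (((z : ℤ × ℤ).1 : ℤ) : ZMod 2) = 0
    rw [mem_BF, ZMod.intCast_zmod_eq_zero_iff_dvd]
    simp only [Int.even_iff] at *
    omega
  · have h' : Even (2 * (n : ℤ) - n) := by
      rw [Nat.even_iff] at h
      rw [Int.even_iff]
      omega
    refine HF_equiv n _ (pr n _) (pr_surj n _ ⟨by omega, le_rfl, h'⟩) fun z => ?_
    have hz := ((mem_ZF n _ z).1 z.2).1
    change _ ↔ (z : ℤ × ℤ).1 = 0
    rw [mem_BF]
    omega
  · apply HF_zero
    rw [Nat.even_iff] at h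
    rw [Int.even_iff]
    omega
  · apply HF_zero
    rw [Int.even_iff] at *
    omega

end Stmt1
end

section
/- Let C(m) be the reduced cellular chain complex of the C₂-sphere of the m-fold regular representation and D(m) its ℤ-linear dual complex (defined in the context), with fixed-point subcomplex D(m)^{C₂}. Then for every integer m ≥ 2: H_{−2m}(D(m)^{C₂}) is infinite cyclic if m is even and is isomorphic to ℤ/2 if m is odd; H_i(D(m)^{C₂}) ≅ ℤ/2 for every i with −2m < i ≤ −m−3 and i ≡ m+1 (mod 2); and H_i(D(m)^{C₂}) = 0 for all other i. -/
/-!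
Statement 2: the homology of the fixed-point subcomplex `D(m)^{C₂}` of the
ℤ-linear dual `D(m)` of the reduced cellular chain complex `C(m)` of the
C₂-sphere `S^{mρ₂}`.

We realize `ℤ[C₂]` (and, via the dual basis, its ℤ-linear dual) as `ℤ × ℤ`,
with the generator `γ` of `C₂` acting by the swap `gam` (for the dual, the
action `(γ·f)(x) = f(γx)` is again the swap in the dual basis).  The dual of
the copy of `ℤ` in degree `m` of `C(m)` is embedded as the diagonal `diag`.
The dual complex `D(m)` is concentrated in degrees `-2m ≤ i ≤ -m`, with
differentials the transposes of those of `C(m)`: the transpose of the fold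
map `∂_{m+1}` is the inclusion of the diagonal (degree `-m`), and the
transpose of multiplication by `1 - (-1)^{i-m}γ` is itself (since the swap
is self-transpose), giving the differential in degree `j = 1 - i`.
-/

namespace Stmt2

/-- The generator γ of C₂ acting on ℤ[C₂] ≅ ℤ × ℤ and on its dual
(swap of the (dual) basis). -/
def gam : (ℤ × ℤ) →ₗ[ℤ] (ℤ × ℤ) := (LinearMap.snd ℤ ℤ ℤ).prod (LinearMap.fst ℤ ℤ ℤ)

/-- The γ-fixed subgroup of ℤ[C₂]: the diagonal.  It is also the embedded
copy of the dual of ℤ (degree `-m` of the dual complex). -/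
def diag : AddSubgroup (ℤ × ℤ) := (LinearMap.ker (gam - LinearMap.id)).toAddSubgroup

/-- The chain groups of the dual complex `D(m)`: the dual of `ℤ` in degree
`-m`, the dual of `ℤ[C₂]` in degrees `-2m ≤ i < -m`, and `0` elsewhere. -/
def MD (m : ℕ) (i : ℤ) : AddSubgroup (ℤ × ℤ) :=
  if i = -(m : ℤ) then diag
  else if -(2 * (m : ℤ)) ≤ i ∧ i < -(m : ℤ) then ⊤
  else ⊥

/-- The differentials of `D(m)`: the transposes of the differentials of
`C(m)`.  The differential out of degree `j` is the transpose of
`∂_{1-j} : C(m)_{1-j} → C(m)_{-j}`: for `j = -m` it is the inclusion of the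
diagonal (transpose of the fold map), and for `1 - 2m ≤ j < -m` it is
multiplication by `1 - (-1)^{(1-j)-m}γ`. -/
def dD (m : ℕ) (j : ℤ) : (ℤ × ℤ) →ₗ[ℤ] (ℤ × ℤ) :=
  if j = -(m : ℤ) then LinearMap.id
  else if 1 - 2 * (m : ℤ) ≤ j ∧ j < -(m : ℤ) then
    (if Even (1 - j - (m : ℤ)) then LinearMap.id - gam else LinearMap.id + gam)
  else 0

/-- the chain groups of the fixed-point subcomplex `D(m)^{C₂}` -/
def MDF (m : ℕ) (i : ℤ) : AddSubgroup (ℤ × ℤ) := MD m i ⊓ diag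

/-- cycles of `D(m)^{C₂}` in degree `i` -/
def ZDF (m : ℕ) (i : ℤ) : AddSubgroup (ℤ × ℤ) :=
  MDF m i ⊓ (LinearMap.ker (dD m i)).toAddSubgroup

/-- boundaries of `D(m)^{C₂}` in degree `i` -/
def BDF (m : ℕ) (i : ℤ) : AddSubgroup (ℤ × ℤ) :=
  (MDF m (i + 1)).map (dD m (i + 1)).toAddMonoidHom

/-- homology of `D(m)^{C₂}` in degree `i` -/
abbrev HFD (m : ℕ) (i : ℤ) := ZDF m i ⧸ (BDF m i).addSubgroupOf (ZDF m i)

theorem mem_diag (p : ℤ × ℤ) : p ∈ diag ↔ p.2 = p.1 := by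
  simp [diag, gam, Prod.ext_iff, sub_eq_zero]
  exact fun h => h.symm

theorem quot_equiv {A : Type} [AddCommGroup A] (Z B : AddSubgroup (ℤ × ℤ)) (φ : ℤ →+ A)
    (hφ : Function.Surjective φ) (hZ : ∀ p, p ∈ Z ↔ p.2 = p.1)
    (hB : ∀ p : ℤ × ℤ, p.2 = p.1 → (p ∈ B ↔ φ p.1 = 0)) :
    Nonempty ((Z ⧸ B.addSubgroupOf Z) ≃+ A) := by
  let ψ : Z →+ A := φ.comp ((AddMonoidHom.fst ℤ ℤ).comp Z.subtype)
  have hs : Function.Surjective ψ := by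
    intro a
    obtain ⟨n, rfl⟩ := hφ a
    exact ⟨⟨(n, n), (hZ _).2 rfl⟩, rfl⟩
  have hk : B.addSubgroupOf Z = ψ.ker := by
    ext ⟨p, hp⟩
    rw [AddSubgroup.mem_addSubgroupOf, AddMonoidHom.mem_ker]
    exact hB p ((hZ p).1 hp)
  exact ⟨(QuotientAddGroup.quotientAddEquivOfEq hk).trans
    (QuotientAddGroup.quotientKerEquivOfSurjective ψ hs)⟩

theorem mem_MDF (m : ℕ) (i : ℤ) (p : ℤ × ℤ) :
    p ∈ MDF m i ↔ p.2 = p.1 ∧ ((-(2 * (m : ℤ)) ≤ i ∧ i ≤ -(m : ℤ)) ∨ p.1 = 0) := by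
  unfold MDF MD
  rw [AddSubgroup.mem_inf, mem_diag]
  split_ifs with h1 h2
  · rw [mem_diag]; omega
  · simp only [AddSubgroup.mem_top, true_and]; omega
  · rw [AddSubgroup.mem_bot, Prod.ext_iff]
    simp only [Prod.fst_zero, Prod.snd_zero]; omega

/-- the scalar by which the differential acts on the diagonal -/
def sc (m : ℕ) (j : ℤ) : ℤ :=
  if j = -(m : ℤ) then 1
  else if 1 - 2 * (m : ℤ) ≤ j ∧ j < -(m : ℤ) then
    (if Even (1 - j - (m : ℤ)) then 0 else 2)
  else 0

theorem dD_diag (m : ℕ) (j : ℤ) (p : ℤ × ℤ) (hp : p.2 = p.1) :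
    dD m j p = (sc m j * p.1, sc m j * p.1) := by
  unfold dD sc
  split_ifs <;> simp [gam, Prod.ext_iff, hp] <;> omega

theorem mem_ZDF (m : ℕ) (i : ℤ) (p : ℤ × ℤ) :
    p ∈ ZDF m i ↔ (p.2 = p.1 ∧ ((-(2 * (m : ℤ)) ≤ i ∧ i ≤ -(m : ℤ)) ∨ p.1 = 0)) ∧
      sc m i * p.1 = 0 := by
  unfold ZDF
  rw [AddSubgroup.mem_inf, mem_MDF]
  refine and_congr_right fun h => ?_
  rw [Submodule.mem_toAddSubgroup, LinearMap.mem_ker, dD_diag m i p h.1, Prod.ext_iff]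
  simp only [Prod.fst_zero, Prod.snd_zero, and_self]

theorem mem_BDF (m : ℕ) (i : ℤ) (p : ℤ × ℤ) (hp : p.2 = p.1) :
    p ∈ BDF m i ↔ ∃ n : ℤ, ((-(2 * (m : ℤ)) ≤ i + 1 ∧ i + 1 ≤ -(m : ℤ)) ∨ n = 0) ∧
      sc m (i + 1) * n = p.1 := by
  unfold BDF
  rw [AddSubgroup.mem_map]
  constructor
  · rintro ⟨q, hq, h⟩
    rw [mem_MDF] at hq
    refine ⟨q.1, hq.2, ?_⟩
    have h' : dD m (i + 1) q = p := h
    rw [dD_diag m _ q hq.1] at h'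
    rw [← h']
  · rintro ⟨n, hn, h⟩
    refine ⟨(n, n), (mem_MDF _ _ _).2 ⟨rfl, hn⟩, ?_⟩
    change dD m (i + 1) (n, n) = p
    rw [dD_diag m _ _ rfl]
    exact Prod.ext h (h.trans hp.symm)

theorem quot_two (m : ℕ) (i : ℤ) (h1 : -(2 * (m : ℤ)) ≤ i) (h2 : i ≤ -(m : ℤ))
    (h3 : sc m i = 0) (h4 : sc m (i + 1) = 2) (h5 : i + 1 ≤ -(m : ℤ)) :
    Nonempty (HFD m i ≃+ ZMod 2) := by
  refine quot_equiv _ _ (Int.castAddHom (ZMod 2)) (ZMod.intCast_surjective) ?_ ?_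
  · intro p
    rw [mem_ZDF, h3]; omega
  · intro p hp
    rw [mem_BDF _ _ _ hp, h4, Int.coe_castAddHom, ZMod.intCast_zmod_eq_zero_iff_dvd]
    constructor
    · rintro ⟨n, _, h⟩; exact ⟨n, h.symm⟩
    · rintro ⟨n, h⟩; exact ⟨n, Or.inl (by omega), h.symm⟩

/-- For `m ≥ 2`: `H_{-2m}(D(m)^{C₂})` is infinite cyclic for `m` even and
`ℤ/2` for `m` odd; `H_i(D(m)^{C₂}) ≅ ℤ/2` for `-2m < i ≤ -m-3` with
`i ≡ m+1 (mod 2)`; and `H_i(D(m)^{C₂}) = 0` for all other `i`. -/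
theorem statement2 (m : ℕ) (hm : 2 ≤ m) :
    (Even m → Nonempty (HFD m (-(2 * (m : ℤ))) ≃+ ℤ)) ∧
    (¬ Even m → Nonempty (HFD m (-(2 * (m : ℤ))) ≃+ ZMod 2)) ∧
    (∀ i : ℤ, -(2 * (m : ℤ)) < i → i ≤ -(m : ℤ) - 3 → Even (i - ((m : ℤ) + 1)) →
      Nonempty (HFD m i ≃+ ZMod 2)) ∧
    (∀ i : ℤ, i ≠ -(2 * (m : ℤ)) →
      ¬ (-(2 * (m : ℤ)) < i ∧ i ≤ -(m : ℤ) - 3 ∧ Even (i - ((m : ℤ) + 1))) →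
      ∀ x : HFD m i, x = 0) := by
  simp only [Int.even_iff, Nat.even_iff]
  refine ⟨fun he => ?_, fun ho => ?_, fun i h1 h2 h3 => ?_, fun i h1 h2 x => ?_⟩
  · have h0 : sc m (-(2 * (m : ℤ))) = 0 := by
      unfold sc; simp only [Int.even_iff]; split_ifs <;> omega
    have h0' : sc m (-(2 * (m : ℤ)) + 1) = 0 := by
      unfold sc; simp only [Int.even_iff]; split_ifs <;> omega
    refine quot_equiv _ _ (AddMonoidHom.id ℤ) (fun a => ⟨a, rfl⟩) ?_ ?_
    · intro p
      rw [mem_ZDF, h0]; omega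
    · intro p hp
      rw [mem_BDF _ _ _ hp, h0', AddMonoidHom.id_apply]
      constructor
      · rintro ⟨n, _, h⟩; omega
      · intro h; exact ⟨0, Or.inr rfl, by omega⟩
  · apply quot_two <;> try omega
    all_goals (unfold sc; simp only [Int.even_iff]; split_ifs <;> omega)
  · apply quot_two <;> try omega
    all_goals (unfold sc; simp only [Int.even_iff]; split_ifs <;> omega)
  · obtain ⟨⟨p, hp⟩, rfl⟩ := QuotientAddGroup.mk_surjective x
    rw [QuotientAddGroup.eq_zero_iff, AddSubgroup.mem_addSubgroupOf]
    rw [mem_ZDF] at hp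
    change p ∈ BDF m i
    rw [mem_BDF _ _ _ hp.1.1]
    by_cases hz : p.1 = 0
    · exact ⟨0, Or.inr rfl, by omega⟩
    have hs : sc m i = 0 := (mul_eq_zero.1 hp.2).resolve_right hz
    have hi : i = -(m : ℤ) - 1 := by
      unfold sc at hs
      simp only [Int.even_iff] at hs
      split_ifs at hs <;> omega
    subst hi
    refine ⟨p.1, Or.inl (by omega), ?_⟩
    simp [sc]

end Stmt2
end

section
/- Let n ≥ 1 be ODD and let C(n) be the reduced cellular chain complex of the C₄-sphere of the n-fold regular representation (defined in the context). Then: H_{4n}(C(n)^{C₄}) = 0; H_{4n}(C(n)^{C₂}) and H_{4n}(C(n)) are infinite cyclic and the map between them induced by the inclusion C(n)^{C₂} ⊆ C(n) is an isomorphism; γ acts on H_{4n}(C(n)) by multiplication by −1; and the trace map x ↦ x + γ²x from C(n) to C(n)^{C₂} induces multiplication by 2 on H_{4n}. (This is the instance V = nρ₄, n odd, of the Proposition that for a nonoriented representation V the top homology Mackey functor H̲_{|V|}S^V is ℤ̲₋, which vanishes at the top level, has each restriction among proper subgroups an isomorphism, each transfer among proper levels multiplication by the index, and sign action by the Weyl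 group.) -/
/-!
Statement 5: for `n ≥ 1` ODD, the top homology `H_{4n}` of the fixed-point
subcomplexes `C(n)^H` (for `H = {1}, C₂, C₄`) of the reduced cellular chain
complex of the C₄-sphere `S^{nρ₄}` realizes the Mackey functor `ℤ̲₋`:
it vanishes at the top level `C₄`, the inclusion-induced map between the
other two levels is an isomorphism, γ acts by `-1` on the bottom level, and
the trace from the bottom level induces multiplication by 2.

We realize `ℤ[C₄]` as `V := ZMod 4 → ℤ`, with the generator `γ` acting by
the shift `gam`; the `C₂`-fixed submodule is `sub2` (γ²-invariants) and the
`C₄`-fixed submodule is `consts` (γ-invariants).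
-/

namespace Stmt5

/-- ℤ[C₄] realized as functions `ZMod 4 → ℤ`. -/
abbrev V := ZMod 4 → ℤ

/-- The generator γ of C₄ acting on ℤ[C₄] (shift of the basis). -/
def gam : V →ₗ[ℤ] V where
  toFun f := fun c => f (c - 1)
  map_add' _ _ := rfl
  map_smul' _ _ := rfl

/-- γ² -/
def gam2 : V →ₗ[ℤ] V := gam ∘ₗ gam

/-- multiplication by `1 + γ²` (the quotient map onto `ℤ[C₄/C₂]`) -/
def P2 : V →ₗ[ℤ] V := LinearMap.id + gam2

/-- multiplication by `γ_t = 1 - (-1)^t γ` -/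
def g (t : ℤ) : V →ₗ[ℤ] V :=
  if Even t then LinearMap.id - gam else LinearMap.id + gam

/-- the γ-fixed (C₄-fixed) submodule: constant functions; this is also the
copy of ℤ with trivial action -/
def consts : AddSubgroup V := (LinearMap.ker (gam - LinearMap.id)).toAddSubgroup

/-- the γ²-fixed (C₂-fixed) submodule: this is also the copy of ℤ[C₄/C₂] -/
def sub2 : AddSubgroup V := (LinearMap.ker (gam2 - LinearMap.id)).toAddSubgroup

/-- The chain groups of `C(n)`. -/
def M (n : ℕ) (i : ℤ) : AddSubgroup V :=
  if i = (n : ℤ) then consts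
  else if (n : ℤ) < i ∧ i ≤ 2 * (n : ℤ) then sub2
  else if 2 * (n : ℤ) < i ∧ i ≤ 4 * (n : ℤ) then ⊤
  else ⊥

/-- The differentials of `C(n)`, as endomorphisms of the ambient `V`. -/
def d (n : ℕ) (j : ℤ) : V →ₗ[ℤ] V :=
  if (n : ℤ) < j ∧ j ≤ 2 * (n : ℤ) then g (j - (n : ℤ))
  else if j = 2 * (n : ℤ) + 1 then P2 ∘ₗ g ((n : ℤ) + 1)
  else if 2 * (n : ℤ) + 1 < j ∧ j ≤ 4 * (n : ℤ) then
    (if Even (j - 1) then g (j - (n : ℤ)) ∘ₗ P2 else g (j - (n : ℤ)))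
  else 0

/-- cycles of the fixed-point subcomplex `C(n)^H` in degree `i`, where
`F` is the `H`-fixed subgroup of `V` (`⊤` for `H = 1`, `sub2` for `H = C₂`,
`consts` for `H = C₄`) -/
def Zf (n : ℕ) (F : AddSubgroup V) (i : ℤ) : AddSubgroup V :=
  (M n i ⊓ F) ⊓ (LinearMap.ker (d n i)).toAddSubgroup

/-- boundaries of the fixed-point subcomplex `C(n)^H` in degree `i` -/
def Bf (n : ℕ) (F : AddSubgroup V) (i : ℤ) : AddSubgroup V :=
  ((M n (i + 1)) ⊓ F).map (d n (i + 1)).toAddMonoidHom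

/-- homology of `C(n)^H` in degree `i` -/
abbrev Hf (n : ℕ) (F : AddSubgroup V) (i : ℤ) :=
  Zf n F i ⧸ (Bf n F i).addSubgroupOf (Zf n F i)

/-- the quotient map from cycles to homology -/
def pf (n : ℕ) (F : AddSubgroup V) (i : ℤ) : Zf n F i →+ Hf n F i :=
  QuotientAddGroup.mk' _


theorem mem_Zf (n : ℕ) (hn : 1 ≤ n) (hodd : Odd n) (F : AddSubgroup V) (z : V) :
    z ∈ Zf n F (4 * (n : ℤ)) ↔ z ∈ F ∧ ∀ c, z c + z (c - 1) = 0 := by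
  have hM : M n (4 * (n : ℤ)) = ⊤ := by
    unfold M
    rw [if_neg (by omega), if_neg (by omega), if_pos (by omega)]
  have hd : d n (4 * (n : ℤ)) = LinearMap.id + gam := by
    obtain ⟨k, rfl⟩ := hodd
    unfold d
    rw [if_neg (by omega), if_neg (by omega), if_pos (by omega), if_neg, g, if_neg]
    · rw [Int.even_iff]; push_cast; omega
    · rw [Int.even_iff]; push_cast; omega
  unfold Zf
  rw [hM, hd, top_inf_eq, AddSubgroup.mem_inf]
  refine and_congr_right fun _ => ?_
  rw [Submodule.mem_toAddSubgroup, LinearMap.mem_ker, funext_iff]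
  rfl

theorem Bf_bot (n : ℕ) (hn : 1 ≤ n) (F : AddSubgroup V) : Bf n F (4 * (n : ℤ)) = ⊥ := by
  have hM : M n (4 * (n : ℤ) + 1) = ⊥ := by
    unfold M
    rw [if_neg (by omega), if_neg (by omega), if_neg (by omega)]
  unfold Bf
  rw [hM, bot_inf_eq, AddSubgroup.map_bot]

theorem alt_vals (z : V) (h : ∀ c, z c + z (c - 1) = 0) :
    z 1 = - z 0 ∧ z 2 = z 0 ∧ z 3 = - z 0 := by
  have h1 : z 1 + z 0 = 0 := h 1
  have h2 : z 2 + z 1 = 0 := h 2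
  have h3 : z 3 + z 2 = 0 := h 3
  omega

theorem alt_ext (z w : V) (h : ∀ c, z c + z (c - 1) = 0) (h' : ∀ c, w c + w (c - 1) = 0)
    (h0 : z 0 = w 0) : z = w := by
  obtain ⟨a, b, c⟩ := alt_vals z h
  obtain ⟨a', b', c'⟩ := alt_vals w h'
  have e1 : z 1 = w 1 := by omega
  have e2 : z 2 = w 2 := by omega
  have e3 : z 3 = w 3 := by omega
  funext i
  change Fin 4 at i
  fin_cases i
  · exact h0
  · exact e1
  · exact e2
  · exact e3

/-- the alternating function with value `a` at `0` -/
def altf (a : ℤ) : V := fun c => if c = 0 ∨ c = 2 then a else -a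

theorem altf_cyc (a : ℤ) (c : ZMod 4) : altf a c + altf a (c - 1) = 0 := by
  have key : ∀ c : ZMod 4, (c = 0 ∨ c = 2) ↔ ¬ (c - 1 = 0 ∨ c - 1 = 2) := by decide
  unfold altf
  by_cases h : c - 1 = 0 ∨ c - 1 = 2
  · rw [if_pos h, if_neg (by rw [key c]; exact not_not.mpr h)]; ring
  · rw [if_neg h, if_pos ((key c).mpr h)]; ring

theorem mem_sub2_of (z : V) (h : ∀ c, z c + z (c - 1) = 0) : z ∈ sub2 := by
  unfold sub2
  rw [Submodule.mem_toAddSubgroup, LinearMap.mem_ker, funext_iff]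
  intro c
  change z (c - 1 - 1) - z c = 0
  have h1 := h c
  have h2 := h (c - 1)
  omega

theorem exists_equiv (n : ℕ) (hn : 1 ≤ n) (hodd : Odd n) (F : AddSubgroup V)
    (hF : ∀ z : V, (∀ c, z c + z (c - 1) = 0) → z ∈ F) :
    ∃ e : Hf n F (4 * (n : ℤ)) ≃+ ℤ, ∀ z : Zf n F (4 * (n : ℤ)),
      e (pf n F (4 * (n : ℤ)) z) = (z : V) 0 := by
  let ev : Zf n F (4 * (n : ℤ)) →+ ℤ :=
    (Pi.evalAddMonoidHom (fun _ : ZMod 4 => ℤ) 0).comp (AddSubgroup.subtype _)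
  have hle : (Bf n F (4 * (n : ℤ))).addSubgroupOf (Zf n F (4 * (n : ℤ))) ≤ ev.ker := by
    intro x hx
    rw [AddSubgroup.mem_addSubgroupOf, Bf_bot n hn, AddSubgroup.mem_bot] at hx
    rw [AddMonoidHom.mem_ker]
    change (x : V) 0 = 0
    rw [hx]; rfl
  let L : Hf n F (4 * (n : ℤ)) →+ ℤ := QuotientAddGroup.lift _ ev hle
  have hL : ∀ z, L (pf n F (4 * (n : ℤ)) z) = (z : V) 0 := fun z => rfl
  have hbij : Function.Bijective L := by
    constructor
    · rw [injective_iff_map_eq_zero]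
      intro x hx
      obtain ⟨z, rfl⟩ := QuotientAddGroup.mk'_surjective _ x
      have h0 : (z : V) 0 = 0 := hx
      have hz : z = 0 := by
        apply Subtype.ext
        exact alt_ext _ _ ((mem_Zf n hn hodd F _).1 z.2).2 (fun c => rfl) h0
      rw [hz, map_zero]
    · intro a
      refine ⟨pf n F _ ⟨altf a, (mem_Zf n hn hodd F _).2 ⟨hF _ (altf_cyc a), altf_cyc a⟩⟩, ?_⟩
      rw [hL]
      simp [altf]
  exact ⟨AddEquiv.ofBijective L hbij, hL⟩

/-- For `n ≥ 1` odd: `H_{4n}(C(n)^{C₄}) = 0`; `H_{4n}(C(n)^{C₂})` and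
`H_{4n}(C(n))` are infinite cyclic and the inclusion-induced map between
them is an isomorphism; `γ` acts on `H_{4n}(C(n))` by multiplication by
`-1`; and the trace map `x ↦ x + γ²x` from `C(n)` to `C(n)^{C₂}` induces
multiplication by 2 on `H_{4n}` (under the inclusion-induced
identification). -/
theorem statement5 (n : ℕ) (hn : 1 ≤ n) (hodd : Odd n) :
    (∀ x : Hf n consts (4 * (n : ℤ)), x = 0) ∧
    Nonempty (Hf n sub2 (4 * (n : ℤ)) ≃+ ℤ) ∧
    Nonempty (Hf n ⊤ (4 * (n : ℤ)) ≃+ ℤ) ∧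
    -- γ acts on H_{4n}(C(n)) by multiplication by -1
    (∀ z : Zf n ⊤ (4 * (n : ℤ)),
      ∃ hz : gam (z : V) ∈ Zf n ⊤ (4 * (n : ℤ)),
        pf n ⊤ (4 * (n : ℤ)) ⟨gam (z : V), hz⟩ =
          - pf n ⊤ (4 * (n : ℤ)) z) ∧
    ∃ φ2 : Hf n sub2 (4 * (n : ℤ)) ≃+ Hf n ⊤ (4 * (n : ℤ)),
      -- φ2 is induced by the inclusion C(n)^{C₂} ⊆ C(n)
      (∀ z : Zf n sub2 (4 * (n : ℤ)), ∃ hz : (z : V) ∈ Zf n ⊤ (4 * (n : ℤ)),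
        φ2 (pf n sub2 (4 * (n : ℤ)) z) = pf n ⊤ (4 * (n : ℤ)) ⟨(z : V), hz⟩) ∧
      -- the trace x ↦ x + γ²x induces multiplication by 2 under φ2
      (∀ z : Zf n ⊤ (4 * (n : ℤ)),
        ∃ hz : ((z : V) + gam2 (z : V)) ∈ Zf n sub2 (4 * (n : ℤ)),
        φ2 (pf n sub2 (4 * (n : ℤ)) ⟨(z : V) + gam2 (z : V), hz⟩) =
          (2 : ℤ) • pf n ⊤ (4 * (n : ℤ)) z) := by
  obtain ⟨e2, he2⟩ := exists_equiv n hn hodd sub2 mem_sub2_of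
  obtain ⟨e1, he1⟩ := exists_equiv n hn hodd ⊤ (fun _ _ => AddSubgroup.mem_top _)
  refine ⟨?_, ⟨e2⟩, ⟨e1⟩, ?_, e2.trans e1.symm, ?_, ?_⟩
  · intro x
    obtain ⟨z, rfl⟩ := QuotientAddGroup.mk'_surjective _ x
    obtain ⟨hc, hz⟩ := (mem_Zf n hn hodd consts _).1 z.2
    unfold consts at hc
    rw [Submodule.mem_toAddSubgroup, LinearMap.mem_ker, funext_iff] at hc
    have h1 : (z : V) 0 - (z : V) 1 = 0 := hc 1
    have h2 := (alt_vals _ hz).1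
    have hz0 : z = 0 := by
      apply Subtype.ext
      refine alt_ext _ _ hz (fun c => rfl) ?_
      change (z : V) 0 = 0
      omega
    rw [hz0, map_zero]
  · intro z
    have hz := ((mem_Zf n hn hodd ⊤ _).1 z.2).2
    refine ⟨(mem_Zf n hn hodd ⊤ _).2 ⟨AddSubgroup.mem_top _, fun c => hz (c - 1)⟩, ?_⟩
    apply e1.injective
    rw [map_neg, he1, he1]
    change (z : V) 3 = - (z : V) 0
    exact (alt_vals _ hz).2.2
  · intro z
    have hz := ((mem_Zf n hn hodd sub2 _).1 z.2).2
    refine ⟨(mem_Zf n hn hodd ⊤ _).2 ⟨AddSubgroup.mem_top _, hz⟩, ?_⟩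
    apply e1.injective
    rw [AddEquiv.trans_apply, AddEquiv.apply_symm_apply, he1, he2]
  · intro z
    have hz := ((mem_Zf n hn hodd ⊤ _).1 z.2).2
    have hw : ∀ c, ((z : V) + gam2 (z : V)) c + ((z : V) + gam2 (z : V)) (c - 1) = 0 := by
      intro c
      change ((z : V) c + (z : V) (c - 1 - 1)) +
        ((z : V) (c - 1) + (z : V) (c - 1 - 1 - 1)) = 0
      have h1 := hz c
      have h2 := hz (c - 1 - 1)
      omega
    refine ⟨(mem_Zf n hn hodd sub2 _).2 ⟨mem_sub2_of _ hw, hw⟩, ?_⟩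
    apply e1.injective
    rw [AddEquiv.trans_apply, AddEquiv.apply_symm_apply, map_zsmul, he1, he2]
    change (z : V) 0 + (z : V) 2 = 2 * (z : V) 0
    have h2 := (alt_vals _ hz).2.1
    omega

end Stmt5
end

section
/- Let n ≥ 1 be EVEN, let C(n) be the reduced cellular chain complex of the C₄-sphere of the n-fold regular representation, and let D(n) be its ℤ-linear dual complex (defined in the context). Then the bottom homology H_{−4n} of each fixed-point subcomplex D(n)^H, for H each of {1}, C₂, C₄, is infinite cyclic; generators can be chosen so that each of the inclusion-induced maps H_{−4n}(D(n)^{C₄}) → H_{−4n}(D(n)^{C₂}) and H_{−4n}(D(n)^{C₂}) → H_{−4n}(D(n)) is multiplication by 2, while each of the trace-induced maps H_{−4n}(D(n)) → H_{−4n}(D(n)^{C₂}) and H_{−4n}(D(n)^{C₂}) → H_{−4n}(D(n)^{C₄}) is an isomorphism. (This is the instance V = nρ₄, n even, G_V = {1}, of the Proposition that H̲_{−|V|}S^{−V} is the Mackey functor ℤ̲(G,G_V), in which restrictions above the isotropy group are multiplication by the index and the corresponding transfers are isomorphisms; here ℤ̲(G,1) is the dual ℤ̲*.) -/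
/-!
Statement 6: for `n ≥ 1` EVEN, the bottom homology `H_{-4n}` of the
fixed-point subcomplexes `D(n)^H` (for `H = {1}, C₂, C₄`) of the ℤ-linear
dual `D(n)` of the reduced cellular chain complex `C(n)` of the C₄-sphere
`S^{nρ₄}` realizes the Mackey functor `ℤ̲(G,1) = ℤ̲*`: each is infinite
cyclic, and generators can be chosen so that each inclusion-induced map is
multiplication by 2 while each trace-induced map is an isomorphism.

We realize `ℤ[C₄]` and (via the dual basis) its ℤ-linear dual as
`V := ZMod 4 → ℤ`.  The γ-action on the dual, `(γ·f)(x) = f(γx)`, is the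
inverse shift `gamD`.  The duals of the copy of `ℤ` and of `ℤ[C₄/C₂]` are
embedded as the constants `constsD` and the γ²-invariants `sub2D`, and the
differentials of `D(n)` are the transposes of those of `C(n)`: the transpose
of the augmentation is the inclusion of the constants; the transpose of
multiplication by `γ_t = 1 - (-1)^t γ` is multiplication by
`1 - (-1)^t γ⁻¹` (the map `gD t`); the transpose of the quotient map
`1 + γ²` is `1 + γ²` itself (giving `P2D`).
-/

namespace Stmt6

/-- ℤ[C₄] (and its ℤ-linear dual, via the dual basis) realized as functions
`ZMod 4 → ℤ`. -/
abbrev V := ZMod 4 → ℤ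

/-- The action of the generator γ of C₄ on the dual of ℤ[C₄]:
`(γ·f)(x) = f(γx)`, i.e. the inverse shift of the dual basis. -/
def gamD : V →ₗ[ℤ] V where
  toFun f := fun c => f (c + 1)
  map_add' _ _ := rfl
  map_smul' _ _ := rfl

/-- γ² acting on the dual -/
def gamD2 : V →ₗ[ℤ] V := gamD ∘ₗ gamD

/-- the transpose of multiplication by `1 + γ²` -/
def P2D : V →ₗ[ℤ] V := LinearMap.id + gamD2

/-- the transpose of multiplication by `γ_t = 1 - (-1)^t γ` -/
def gD (t : ℤ) : V →ₗ[ℤ] V :=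
  if Even t then LinearMap.id - gamD else LinearMap.id + gamD

/-- the γ-fixed (C₄-fixed) subgroup of the dual: constants. This is also the
embedded dual of the copy of ℤ (degree `-n` of `D(n)`). -/
def constsD : AddSubgroup V := (LinearMap.ker (gamD - LinearMap.id)).toAddSubgroup

/-- the γ²-fixed (C₂-fixed) subgroup of the dual. This is also the embedded
dual of `ℤ[C₄/C₂]` (degrees `-2n ≤ w < -n` of `D(n)`). -/
def sub2D : AddSubgroup V := (LinearMap.ker (gamD2 - LinearMap.id)).toAddSubgroup

/-- The chain groups of the dual complex `D(n)`, concentrated in degrees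
`-4n ≤ w ≤ -n`: the dual of `ℤ` in degree `-n`, the dual of `ℤ[C₄/C₂]` in
degrees `-2n ≤ w < -n`, and the dual of `ℤ[C₄]` in degrees
`-4n ≤ w < -2n`. -/
def MD (n : ℕ) (w : ℤ) : AddSubgroup V :=
  if w = -(n : ℤ) then constsD
  else if -(2 * (n : ℤ)) ≤ w ∧ w < -(n : ℤ) then sub2D
  else if -(4 * (n : ℤ)) ≤ w ∧ w < -(2 * (n : ℤ)) then ⊤
  else ⊥

/-- The differentials of `D(n)`: the transposes of the differentials of
`C(n)`.  The differential out of degree `w` is the transpose of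
`∂_{1-w} : C(n)_{1-w} → C(n)_{-w}`: in degree `-n` it is the inclusion of
the constants (transpose of the augmentation); in degrees `-2n ≤ w < -n`
it is `gD ((1-w)-n)` (in degree `-2n` this is the transpose of the
composite of multiplication by `γ_{n+1}` with the quotient map, since the
transpose of the quotient map is the inclusion `sub2D ⊆ V`); in degrees
`1-4n ≤ w < -2n` it is the transpose of multiplication by `μ_{(1-w)-n}`
when `(1-w)-1` is even (i.e. `w` is even) and of multiplication by
`γ_{(1-w)-n}` when `w` is odd. -/
def dD (n : ℕ) (w : ℤ) : V →ₗ[ℤ] V :=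
  if w = -(n : ℤ) then LinearMap.id
  else if -(2 * (n : ℤ)) ≤ w ∧ w < -(n : ℤ) then gD (1 - w - (n : ℤ))
  else if 1 - 4 * (n : ℤ) ≤ w ∧ w < -(2 * (n : ℤ)) then
    (if Even w then gD (1 - w - (n : ℤ)) ∘ₗ P2D else gD (1 - w - (n : ℤ)))
  else 0

/-- cycles of the fixed-point subcomplex `D(n)^H` in degree `w`, where `F`
is the `H`-fixed subgroup of `V` (`⊤` for `H = 1`, `sub2D` for `H = C₂`,
`constsD` for `H = C₄`) -/
def ZD (n : ℕ) (F : AddSubgroup V) (w : ℤ) : AddSubgroup V :=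
  (MD n w ⊓ F) ⊓ (LinearMap.ker (dD n w)).toAddSubgroup

/-- boundaries of the fixed-point subcomplex `D(n)^H` in degree `w` -/
def BD (n : ℕ) (F : AddSubgroup V) (w : ℤ) : AddSubgroup V :=
  ((MD n (w + 1)) ⊓ F).map (dD n (w + 1)).toAddMonoidHom

/-- homology of `D(n)^H` in degree `w` -/
abbrev HD (n : ℕ) (F : AddSubgroup V) (w : ℤ) :=
  ZD n F w ⧸ (BD n F w).addSubgroupOf (ZD n F w)

/-- the quotient map from cycles to homology -/
def pD (n : ℕ) (F : AddSubgroup V) (w : ℤ) : ZD n F w →+ HD n F w :=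
  QuotientAddGroup.mk' _

theorem mem_ZD (n : ℕ) (hn : 1 ≤ n) (F : AddSubgroup V) (z : V) :
    z ∈ ZD n F (-(4 * (n : ℤ))) ↔ z ∈ F := by
  have h1 : ¬ (-(4 * (n : ℤ)) = -(n : ℤ)) := by omega
  have h2 : ¬ (-(2 * (n : ℤ)) ≤ -(4 * (n : ℤ)) ∧ -(4 * (n : ℤ)) < -(n : ℤ)) := by omega
  have h3 : -(4 * (n : ℤ)) ≤ -(4 * (n : ℤ)) ∧ -(4 * (n : ℤ)) < -(2 * (n : ℤ)) := by omega
  have h4 : ¬ (1 - 4 * (n : ℤ) ≤ -(4 * (n : ℤ)) ∧ -(4 * (n : ℤ)) < -(2 * (n : ℤ))) := by omega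
  have hM : MD n (-(4 * (n : ℤ))) = ⊤ := by
    unfold MD
    rw [if_neg h1, if_neg h2, if_pos h3]
  have hd : dD n (-(4 * (n : ℤ))) = 0 := by
    unfold dD
    rw [if_neg h1, if_neg h2, if_neg h4]
  unfold ZD
  rw [hM, hd]
  simp

theorem mem_BD (n : ℕ) (hn : 1 ≤ n) (hev : Even n) (F : AddSubgroup V) (z : V) :
    z ∈ BD n F (-(4 * (n : ℤ))) ↔ ∃ x ∈ F, x - gamD x = z := by
  obtain ⟨k, hk⟩ := hev
  have h1 : ¬ (-(4 * (n : ℤ)) + 1 = -(n : ℤ)) := by omega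
  have h2 : ¬ (-(2 * (n : ℤ)) ≤ -(4 * (n : ℤ)) + 1 ∧ -(4 * (n : ℤ)) + 1 < -(n : ℤ)) := by omega
  have h3 : -(4 * (n : ℤ)) ≤ -(4 * (n : ℤ)) + 1 ∧ -(4 * (n : ℤ)) + 1 < -(2 * (n : ℤ)) := by omega
  have h4 : 1 - 4 * (n : ℤ) ≤ -(4 * (n : ℤ)) + 1 ∧
      -(4 * (n : ℤ)) + 1 < -(2 * (n : ℤ)) := by omega
  have h5 : ¬ Even (-(4 * (n : ℤ)) + 1) := by
    rintro ⟨m, hm⟩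
    omega
  have h6 : Even (1 - (-(4 * (n : ℤ)) + 1) - (n : ℤ)) := ⟨3 * k, by omega⟩
  have hM : MD n (-(4 * (n : ℤ)) + 1) = ⊤ := by
    unfold MD
    rw [if_neg h1, if_neg h2, if_pos h3]
  have hd : dD n (-(4 * (n : ℤ)) + 1) = LinearMap.id - gamD := by
    unfold dD gD
    rw [if_neg h1, if_neg h2, if_pos h4, if_neg h5, if_pos h6]
  unfold BD
  rw [hM, hd]
  simp

theorem mk_equiv (n : ℕ) (hn : 1 ≤ n) (hev : Even n) (F : AddSubgroup V) (φ : V →+ ℤ)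
    (hs : ∀ m : ℤ, ∃ x ∈ F, φ x = m)
    (hk : ∀ z ∈ F, φ z = 0 ↔ ∃ x ∈ F, x - gamD x = z) :
    ∃ e : HD n F (-(4 * (n : ℤ))) ≃+ ℤ,
      ∀ z : ZD n F (-(4 * (n : ℤ))), e (pD n F (-(4 * (n : ℤ))) z) = φ z := by
  let ψ : ZD n F (-(4 * (n : ℤ))) →+ ℤ := φ.comp (AddSubgroup.subtype _)
  have hψ : Function.Surjective ψ := by
    intro m
    obtain ⟨x, hx, h⟩ := hs m
    exact ⟨⟨x, (mem_ZD n hn F x).2 hx⟩, h⟩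
  have hker : (BD n F (-(4 * (n : ℤ)))).addSubgroupOf (ZD n F (-(4 * (n : ℤ)))) = ψ.ker := by
    ext z
    rw [AddSubgroup.mem_addSubgroupOf, mem_BD n hn hev, AddMonoidHom.mem_ker]
    exact (hk z ((mem_ZD n hn F z).1 z.2)).symm
  refine ⟨(QuotientAddGroup.quotientAddEquivOfEq hker).trans
    (QuotientAddGroup.quotientKerEquivOfSurjective ψ hψ), ?_⟩
  intro z
  rfl

theorem mem_sub2D (z : V) : z ∈ sub2D ↔ z 0 = z 2 ∧ z 1 = z 3 := by
  have : z ∈ sub2D ↔ gamD2 z - z = 0 := Iff.rfl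
  rw [this, sub_eq_zero, funext_iff]
  constructor
  · intro h
    exact ⟨(h 0).symm, (h 1).symm⟩
  · rintro ⟨h, h'⟩ c
    fin_cases c
    · exact h.symm
    · exact h'.symm
    · exact h
    · exact h'

theorem mem_constsD (z : V) : z ∈ constsD ↔ z 1 = z 0 ∧ z 2 = z 0 ∧ z 3 = z 0 := by
  have : z ∈ constsD ↔ gamD z - z = 0 := Iff.rfl
  rw [this, sub_eq_zero, funext_iff]
  constructor
  · intro h
    have h0 : z 1 = z 0 := h 0
    have h1 : z 2 = z 1 := h 1
    have h2 : z 3 = z 2 := h 2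
    omega
  · rintro ⟨h, h', h''⟩ c
    fin_cases c
    · exact h
    · exact h'.trans h.symm
    · exact h''.trans h'.symm
    · exact h''.symm

theorem bd_iff (x z : V) : x - gamD x = z ↔
    x 0 - x 1 = z 0 ∧ x 1 - x 2 = z 1 ∧ x 2 - x 3 = z 2 ∧ x 3 - x 0 = z 3 := by
  rw [funext_iff]
  constructor
  · intro h
    exact ⟨h 0, h 1, h 2, h 3⟩
  · rintro ⟨h0, h1, h2, h3⟩ c
    fin_cases c
    · exact h0
    · exact h1
    · exact h2
    · exact h3

/-- a vector from its entries -/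
def vec (a b c d : ℤ) : V := ![a, b, c, d]

theorem vec0 (a b c d : ℤ) : vec a b c d 0 = a := rfl
theorem vec1 (a b c d : ℤ) : vec a b c d 1 = b := rfl
theorem vec2 (a b c d : ℤ) : vec a b c d 2 = c := rfl
theorem vec3 (a b c d : ℤ) : vec a b c d 3 = d := rfl

/-- evaluation -/
def ev (i : ZMod 4) : V →+ ℤ := Pi.evalAddMonoidHom _ i

theorem ev_apply (i : ZMod 4) (z : V) : ev i z = z i := rfl

/-- For `n ≥ 1` even: `H_{-4n}` of each of `D(n)`, `D(n)^{C₂}`, `D(n)^{C₄}`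
is infinite cyclic; generators can be chosen so that the inclusion-induced
maps `H_{-4n}(D(n)^{C₄}) → H_{-4n}(D(n)^{C₂})` and
`H_{-4n}(D(n)^{C₂}) → H_{-4n}(D(n))` are each multiplication by 2, while
the trace-induced maps `H_{-4n}(D(n)) → H_{-4n}(D(n)^{C₂})` (trace
`x ↦ x + γ²x`) and `H_{-4n}(D(n)^{C₂}) → H_{-4n}(D(n)^{C₄})` (trace
`x ↦ x + γx`) are each isomorphisms. -/
theorem statement6 (n : ℕ) (hn : 1 ≤ n) (hev : Even n) :
    ∃ (ef : HD n ⊤ (-(4 * (n : ℤ))) ≃+ ℤ)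
      (e2 : HD n sub2D (-(4 * (n : ℤ))) ≃+ ℤ)
      (e4 : HD n constsD (-(4 * (n : ℤ))) ≃+ ℤ),
      -- the inclusion-induced map H(D^{C₄}) → H(D^{C₂}) is multiplication by 2
      (∀ z : ZD n constsD (-(4 * (n : ℤ))),
        ∃ hz : (z : V) ∈ ZD n sub2D (-(4 * (n : ℤ))),
        e2 (pD n sub2D (-(4 * (n : ℤ))) ⟨(z : V), hz⟩) =
          2 * e4 (pD n constsD (-(4 * (n : ℤ))) z)) ∧
      -- the inclusion-induced map H(D^{C₂}) → H(D) is multiplication by 2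
      (∀ z : ZD n sub2D (-(4 * (n : ℤ))),
        ∃ hz : (z : V) ∈ ZD n ⊤ (-(4 * (n : ℤ))),
        ef (pD n ⊤ (-(4 * (n : ℤ))) ⟨(z : V), hz⟩) =
          2 * e2 (pD n sub2D (-(4 * (n : ℤ))) z)) ∧
      -- the trace-induced map H(D) → H(D^{C₂}) is an isomorphism
      (∀ z : ZD n ⊤ (-(4 * (n : ℤ))),
        ∃ hz : ((z : V) + gamD2 (z : V)) ∈ ZD n sub2D (-(4 * (n : ℤ))),
        e2 (pD n sub2D (-(4 * (n : ℤ))) ⟨(z : V) + gamD2 (z : V), hz⟩) =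
          ef (pD n ⊤ (-(4 * (n : ℤ))) z)) ∧
      -- the trace-induced map H(D^{C₂}) → H(D^{C₄}) is an isomorphism
      (∀ z : ZD n sub2D (-(4 * (n : ℤ))),
        ∃ hz : ((z : V) + gamD (z : V)) ∈ ZD n constsD (-(4 * (n : ℤ))),
        e4 (pD n constsD (-(4 * (n : ℤ))) ⟨(z : V) + gamD (z : V), hz⟩) =
          e2 (pD n sub2D (-(4 * (n : ℤ))) z)) := by
  obtain ⟨ef, hf⟩ := mk_equiv n hn hev ⊤ (ev 0 + ev 1 + ev 2 + ev 3)
    (fun m => ⟨vec m 0 0 0, AddSubgroup.mem_top _, by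
      simp only [AddMonoidHom.add_apply, ev_apply, vec0, vec1, vec2, vec3]; omega⟩)
    (by
      intro z _
      simp only [AddMonoidHom.add_apply, ev_apply, bd_iff]
      constructor
      · intro h
        refine ⟨vec 0 (-z 0) (-z 0 - z 1) (-z 0 - z 1 - z 2), AddSubgroup.mem_top _, ?_⟩
        simp only [vec0, vec1, vec2, vec3]
        omega
      · rintro ⟨x, _, h⟩
        omega)
  obtain ⟨e2, h2⟩ := mk_equiv n hn hev sub2D (ev 0 + ev 1)
    (fun m => ⟨vec m 0 m 0, by
        simp only [mem_sub2D, vec0, vec1, vec2, vec3]; grind, by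
      simp only [AddMonoidHom.add_apply, ev_apply, vec0, vec1]; omega⟩)
    (by
      intro z hz
      rw [mem_sub2D] at hz
      simp only [AddMonoidHom.add_apply, ev_apply, bd_iff, mem_sub2D]
      constructor
      · intro h
        refine ⟨vec (z 0) 0 (z 0) 0, ?_⟩
        simp only [vec0, vec1, vec2, vec3]
        grind
      · rintro ⟨x, _, h⟩
        omega)
  obtain ⟨e4, h4⟩ := mk_equiv n hn hev constsD (ev 0)
    (fun m => ⟨vec m m m m, by
        simp only [mem_constsD, vec0, vec1, vec2, vec3]; grind, by
      simp only [ev_apply, vec0]⟩)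
    (by
      intro z hz
      rw [mem_constsD] at hz
      simp only [ev_apply, bd_iff, mem_constsD]
      constructor
      · intro h
        refine ⟨vec 0 0 0 0, ?_⟩
        simp only [vec0, vec1, vec2, vec3]
        grind
      · rintro ⟨x, _, h⟩
        omega)
  have g0 : ∀ z : V, gamD z 0 = z 1 := fun _ => rfl
  have g1 : ∀ z : V, gamD z 1 = z 2 := fun _ => rfl
  have g2 : ∀ z : V, gamD z 2 = z 3 := fun _ => rfl
  have g3 : ∀ z : V, gamD z 3 = z 0 := fun _ => rfl
  have k0 : ∀ z : V, gamD2 z 0 = z 2 := fun _ => rfl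
  have k1 : ∀ z : V, gamD2 z 1 = z 3 := fun _ => rfl
  have k2 : ∀ z : V, gamD2 z 2 = z 0 := fun _ => rfl
  have k3 : ∀ z : V, gamD2 z 3 = z 1 := fun _ => rfl
  refine ⟨ef, e2, e4, ?_, ?_, ?_, ?_⟩
  · intro z
    have hz := (mem_constsD _).1 ((mem_ZD n hn _ _).1 z.2)
    refine ⟨(mem_ZD n hn _ _).2 ((mem_sub2D _).2 (by omega)), ?_⟩
    rw [h2, h4]
    simp only [AddMonoidHom.add_apply, ev_apply]
    omega
  · intro z
    have hz := (mem_sub2D _).1 ((mem_ZD n hn _ _).1 z.2)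
    refine ⟨(mem_ZD n hn _ _).2 (AddSubgroup.mem_top _), ?_⟩
    rw [h2, hf]
    simp only [AddMonoidHom.add_apply, ev_apply]
    omega
  · intro z
    refine ⟨(mem_ZD n hn _ _).2 ((mem_sub2D _).2 (by
      simp only [Pi.add_apply, k0, k1, k2, k3]; omega)), ?_⟩
    rw [h2, hf]
    simp only [AddMonoidHom.add_apply, ev_apply, Pi.add_apply, k0, k1]
    omega
  · intro z
    have hz := (mem_sub2D _).1 ((mem_ZD n hn _ _).1 z.2)
    refine ⟨(mem_ZD n hn _ _).2 ((mem_constsD _).2 (by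
      simp only [Pi.add_apply, g0, g1, g2, g3]; omega)), ?_⟩
    rw [h2, h4]
    simp only [AddMonoidHom.add_apply, ev_apply, Pi.add_apply, g0]

end Stmt6
end

section
/- Let n ≥ 1 be ODD, let C(n) be the reduced cellular chain complex of the C₄-sphere of the n-fold regular representation, and let D(n) be its ℤ-linear dual complex (defined in the context). Then: H_{−4n}(D(n)^{C₄}) ≅ ℤ/2; H_{−4n}(D(n)^{C₂}) and H_{−4n}(D(n)) are infinite cyclic, with γ acting on H_{−4n}(D(n)) by −1; generators can be chosen so that the inclusion-induced map H_{−4n}(D(n)^{C₂}) → H_{−4n}(D(n)) is multiplication by 2 and the inclusion-induced map H_{−4n}(D(n)^{C₄}) → H_{−4n}(D(n)^{C₂}) is zero; the trace-induced map H_{−4n}(D(n)) → H_{−4n}(D(n)^{C₂}) is an isomorphism; and the trace-induced map H_{−4n}(D(n)^{C₂}) → H_{−4n}(D(n)^{C₄}) is surjective. (This is the instance V = nρ₄, n odd, of the Proposition that H̲_{−|V|}S^{−V} is ℤ̲(G,G_V)₋, whose top value is ℤ/2 when V ≠ σ, with the same restrictions and transfers as ℤ̲(G,G_V).) -/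
/-!
Statement 7: for `n ≥ 1` ODD, the bottom homology `H_{-4n}` of the
fixed-point subcomplexes `D(n)^H` (for `H = {1}, C₂, C₄`) of the ℤ-linear
dual `D(n)` of the reduced cellular chain complex `C(n)` of the C₄-sphere
`S^{nρ₄}` realizes the Mackey functor `ℤ̲(G,1)₋`: it is `ℤ/2` at the top
level and infinite cyclic (with γ acting by `-1` at the bottom level) at
the other two levels; with suitable generators the inclusion-induced map
from the `C₂`-level to the bottom level is multiplication by 2 and the one
from the top level is zero; the trace-induced map from the bottom level is
an isomorphism and the one onto the top level is surjective.

We realize `ℤ[C₄]` and (via the dual basis) its ℤ-linear dual as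
`V := ZMod 4 → ℤ`.  The γ-action on the dual, `(γ·f)(x) = f(γx)`, is the
inverse shift `gamD`.  The duals of the copy of `ℤ` and of `ℤ[C₄/C₂]` are
embedded as the constants `constsD` and the γ²-invariants `sub2D`, and the
differentials of `D(n)` are the transposes of those of `C(n)`: the transpose
of the augmentation is the inclusion of the constants; the transpose of
multiplication by `γ_t = 1 - (-1)^t γ` is multiplication by
`1 - (-1)^t γ⁻¹` (the map `gD t`); the transpose of the quotient map
`1 + γ²` is `1 + γ²` itself (giving `P2D`).
-/

namespace Stmt7

/-- ℤ[C₄] (and its ℤ-linear dual, via the dual basis) realized as functions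
`ZMod 4 → ℤ`. -/
abbrev V := ZMod 4 → ℤ

/-- The action of the generator γ of C₄ on the dual of ℤ[C₄]:
`(γ·f)(x) = f(γx)`, i.e. the inverse shift of the dual basis. -/
def gamD : V →ₗ[ℤ] V where
  toFun f := fun c => f (c + 1)
  map_add' _ _ := rfl
  map_smul' _ _ := rfl

/-- γ² acting on the dual -/
def gamD2 : V →ₗ[ℤ] V := gamD ∘ₗ gamD

/-- the transpose of multiplication by `1 + γ²` -/
def P2D : V →ₗ[ℤ] V := LinearMap.id + gamD2

/-- the transpose of multiplication by `γ_t = 1 - (-1)^t γ` -/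
def gD (t : ℤ) : V →ₗ[ℤ] V :=
  if Even t then LinearMap.id - gamD else LinearMap.id + gamD

/-- the γ-fixed (C₄-fixed) subgroup of the dual: constants. This is also the
embedded dual of the copy of ℤ (degree `-n` of `D(n)`). -/
def constsD : AddSubgroup V := (LinearMap.ker (gamD - LinearMap.id)).toAddSubgroup

/-- the γ²-fixed (C₂-fixed) subgroup of the dual. This is also the embedded
dual of `ℤ[C₄/C₂]` (degrees `-2n ≤ w < -n` of `D(n)`). -/
def sub2D : AddSubgroup V := (LinearMap.ker (gamD2 - LinearMap.id)).toAddSubgroup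

/-- The chain groups of the dual complex `D(n)`, concentrated in degrees
`-4n ≤ w ≤ -n`: the dual of `ℤ` in degree `-n`, the dual of `ℤ[C₄/C₂]` in
degrees `-2n ≤ w < -n`, and the dual of `ℤ[C₄]` in degrees
`-4n ≤ w < -2n`. -/
def MD (n : ℕ) (w : ℤ) : AddSubgroup V :=
  if w = -(n : ℤ) then constsD
  else if -(2 * (n : ℤ)) ≤ w ∧ w < -(n : ℤ) then sub2D
  else if -(4 * (n : ℤ)) ≤ w ∧ w < -(2 * (n : ℤ)) then ⊤
  else ⊥

/-- The differentials of `D(n)`: the transposes of the differentials of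
`C(n)`.  The differential out of degree `w` is the transpose of
`∂_{1-w} : C(n)_{1-w} → C(n)_{-w}`: in degree `-n` it is the inclusion of
the constants (transpose of the augmentation); in degrees `-2n ≤ w < -n`
it is `gD ((1-w)-n)` (in degree `-2n` this is the transpose of the
composite of multiplication by `γ_{n+1}` with the quotient map, since the
transpose of the quotient map is the inclusion `sub2D ⊆ V`); in degrees
`1-4n ≤ w < -2n` it is the transpose of multiplication by `μ_{(1-w)-n}`
when `(1-w)-1` is even (i.e. `w` is even) and of multiplication by
`γ_{(1-w)-n}` when `w` is odd. -/
def dD (n : ℕ) (w : ℤ) : V →ₗ[ℤ] V :=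
  if w = -(n : ℤ) then LinearMap.id
  else if -(2 * (n : ℤ)) ≤ w ∧ w < -(n : ℤ) then gD (1 - w - (n : ℤ))
  else if 1 - 4 * (n : ℤ) ≤ w ∧ w < -(2 * (n : ℤ)) then
    (if Even w then gD (1 - w - (n : ℤ)) ∘ₗ P2D else gD (1 - w - (n : ℤ)))
  else 0

/-- cycles of the fixed-point subcomplex `D(n)^H` in degree `w`, where `F`
is the `H`-fixed subgroup of `V` (`⊤` for `H = 1`, `sub2D` for `H = C₂`,
`constsD` for `H = C₄`) -/
def ZD (n : ℕ) (F : AddSubgroup V) (w : ℤ) : AddSubgroup V :=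
  (MD n w ⊓ F) ⊓ (LinearMap.ker (dD n w)).toAddSubgroup

/-- boundaries of the fixed-point subcomplex `D(n)^H` in degree `w` -/
def BD (n : ℕ) (F : AddSubgroup V) (w : ℤ) : AddSubgroup V :=
  ((MD n (w + 1)) ⊓ F).map (dD n (w + 1)).toAddMonoidHom

/-- homology of `D(n)^H` in degree `w` -/
abbrev HD (n : ℕ) (F : AddSubgroup V) (w : ℤ) :=
  ZD n F w ⧸ (BD n F w).addSubgroupOf (ZD n F w)

/-- the quotient map from cycles to homology -/
def pD (n : ℕ) (F : AddSubgroup V) (w : ℤ) : ZD n F w →+ HD n F w :=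
  QuotientAddGroup.mk' _

theorem MD_bot (n : ℕ) (hn : 1 ≤ n) : MD n (-(4 * (n : ℤ))) = ⊤ := by
  unfold MD
  rw [if_neg (by omega), if_neg (by omega), if_pos (by omega)]

theorem MD_bot1 (n : ℕ) (hn : 1 ≤ n) : MD n (-(4 * (n : ℤ)) + 1) = ⊤ := by
  unfold MD
  rw [if_neg (by omega), if_neg (by omega), if_pos (by omega)]

theorem dD_bot (n : ℕ) (hn : 1 ≤ n) : dD n (-(4 * (n : ℤ))) = 0 := by
  unfold dD
  rw [if_neg (by omega), if_neg (by omega), if_neg (by omega)]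

theorem dD_bot1 (n : ℕ) (hn : 1 ≤ n) (hodd : Odd n) :
    dD n (-(4 * (n : ℤ)) + 1) = LinearMap.id + gamD := by
  obtain ⟨k, rfl⟩ := hodd
  unfold dD gD
  rw [if_neg (by omega), if_neg (by omega), if_pos (by omega),
    if_neg (by rw [Int.even_iff]; omega), if_neg (by rw [Int.even_iff]; push_cast; omega)]

theorem mem_Z (n : ℕ) (hn : 1 ≤ n) (F : AddSubgroup V) (f : V) :
    f ∈ ZD n F (-(4 * (n : ℤ))) ↔ f ∈ F := by
  unfold ZD
  rw [MD_bot n hn, dD_bot n hn]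
  simp [AddSubgroup.mem_inf]

theorem mem_B (n : ℕ) (hn : 1 ≤ n) (hodd : Odd n) (F : AddSubgroup V) (f : V) :
    f ∈ BD n F (-(4 * (n : ℤ))) ↔ ∃ g ∈ F, g + gamD g = f := by
  unfold BD
  rw [MD_bot1 n hn, dD_bot1 n hn hodd]
  simp [AddSubgroup.mem_map]

theorem gam_apply (f : V) (c : ZMod 4) : gamD f c = f (c + 1) := rfl
theorem gam2_apply (f : V) (c : ZMod 4) : gamD2 f c = f (c + 1 + 1) := rfl

theorem ext4 (f g : V) : f = g ↔ f 0 = g 0 ∧ f 1 = g 1 ∧ f 2 = g 2 ∧ f 3 = g 3 := by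
  constructor
  · rintro rfl; simp
  · rintro ⟨h0, h1, h2, h3⟩
    funext c
    fin_cases c
    · exact h0
    · exact h1
    · exact h2
    · exact h3

theorem gam0 (f : V) : gamD f 0 = f 1 := rfl
theorem gam1 (f : V) : gamD f 1 = f 2 := rfl
theorem gam2 (f : V) : gamD f 2 = f 3 := rfl
theorem gam3 (f : V) : gamD f 3 = f 0 := rfl
theorem gamm0 (f : V) : gamD2 f 0 = f 2 := rfl
theorem gamm1 (f : V) : gamD2 f 1 = f 3 := rfl
theorem gamm2 (f : V) : gamD2 f 2 = f 0 := rfl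
theorem gamm3 (f : V) : gamD2 f 3 = f 1 := rfl

theorem mem_consts (f : V) : f ∈ constsD ↔ f 1 = f 0 ∧ f 2 = f 1 ∧ f 3 = f 2 ∧ f 0 = f 3 := by
  have : f ∈ constsD ↔ gamD f = f := by
    simp [constsD, sub_eq_zero]
  rw [this, ext4, gam0, gam1, gam2, gam3]

theorem mem_sub2 (f : V) : f ∈ sub2D ↔ f 2 = f 0 ∧ f 3 = f 1 := by
  have : f ∈ sub2D ↔ gamD2 f = f := by
    simp [sub2D, sub_eq_zero]
  rw [this, ext4, gamm0, gamm1, gamm2, gamm3]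
  grind

/-- the function with the four given values -/
def vec (a b c d : ℤ) : V := (![a, b, c, d] : Fin 4 → ℤ)
theorem vec0 (a b c d : ℤ) : vec a b c d 0 = a := rfl
theorem vec1 (a b c d : ℤ) : vec a b c d 1 = b := rfl
theorem vec2 (a b c d : ℤ) : vec a b c d 2 = c := rfl
theorem vec3 (a b c d : ℤ) : vec a b c d 3 = d := rfl

/-- evaluation at a point, as an additive map -/
def ev (c : ZMod 4) : V →+ ℤ := Pi.evalAddMonoidHom (fun _ : ZMod 4 => ℤ) c
theorem ev_apply (c : ZMod 4) (f : V) : ev c f = f c := rfl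

theorem mkEquiv {A : Type*} [AddCommGroup A] (n : ℕ) (F : AddSubgroup V) (w : ℤ)
    (φ : V →+ A) (hs : ∀ a, ∃ f ∈ ZD n F w, φ f = a)
    (hk : ∀ f ∈ ZD n F w, f ∈ BD n F w ↔ φ f = 0) :
    ∃ e : HD n F w ≃+ A, ∀ z : ZD n F w, e (pD n F w z) = φ z := by
  let ψ : ZD n F w →+ A := φ.comp (ZD n F w).subtype
  have hψ : Function.Surjective ψ := fun a => by
    obtain ⟨f, hf, h⟩ := hs a
    exact ⟨⟨f, hf⟩, h⟩
  have hker : (BD n F w).addSubgroupOf (ZD n F w) = ψ.ker := by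
    ext z
    rw [AddSubgroup.mem_addSubgroupOf, AddMonoidHom.mem_ker]
    exact hk z z.2
  refine ⟨(QuotientAddGroup.quotientAddEquivOfEq hker).trans
    (QuotientAddGroup.quotientKerEquivOfSurjective ψ hψ), fun z => rfl⟩

theorem pD_eq_zero (n : ℕ) (F : AddSubgroup V) (w : ℤ) (z : ZD n F w)
    (h : (z : V) ∈ BD n F w) : pD n F w z = 0 :=
  (QuotientAddGroup.eq_zero_iff z).2 (AddSubgroup.mem_addSubgroupOf.2 h)

/-- For `n ≥ 1` odd: `H_{-4n}(D(n)^{C₄}) ≅ ℤ/2`; `H_{-4n}(D(n)^{C₂})` and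
`H_{-4n}(D(n))` are infinite cyclic, with γ acting on `H_{-4n}(D(n))` by
`-1`; generators can be chosen so that the inclusion-induced map
`H_{-4n}(D(n)^{C₂}) → H_{-4n}(D(n))` is multiplication by 2 and the
inclusion-induced map `H_{-4n}(D(n)^{C₄}) → H_{-4n}(D(n)^{C₂})` is zero;
the trace-induced map `H_{-4n}(D(n)) → H_{-4n}(D(n)^{C₂})` is an
isomorphism; and the trace-induced map
`H_{-4n}(D(n)^{C₂}) → H_{-4n}(D(n)^{C₄})` is surjective. -/
theorem statement7 (n : ℕ) (hn : 1 ≤ n) (hodd : Odd n) :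
    Nonempty (HD n constsD (-(4 * (n : ℤ))) ≃+ ZMod 2) ∧
    -- γ acts on H_{-4n}(D(n)) by multiplication by -1
    (∀ z : ZD n ⊤ (-(4 * (n : ℤ))),
      ∃ hz : gamD (z : V) ∈ ZD n ⊤ (-(4 * (n : ℤ))),
        pD n ⊤ (-(4 * (n : ℤ))) ⟨gamD (z : V), hz⟩ =
          - pD n ⊤ (-(4 * (n : ℤ))) z) ∧
    -- the inclusion-induced map H(D^{C₄}) → H(D^{C₂}) is zero
    (∀ z : ZD n constsD (-(4 * (n : ℤ))),
      ∃ hz : (z : V) ∈ ZD n sub2D (-(4 * (n : ℤ))),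
        pD n sub2D (-(4 * (n : ℤ))) ⟨(z : V), hz⟩ = 0) ∧
    -- the trace-induced map H(D^{C₂}) → H(D^{C₄}) is surjective
    (∀ y : HD n constsD (-(4 * (n : ℤ))),
      ∃ z : ZD n sub2D (-(4 * (n : ℤ))),
      ∃ hz : ((z : V) + gamD (z : V)) ∈ ZD n constsD (-(4 * (n : ℤ))),
        pD n constsD (-(4 * (n : ℤ))) ⟨(z : V) + gamD (z : V), hz⟩ = y) ∧
    ∃ (ef : HD n ⊤ (-(4 * (n : ℤ))) ≃+ ℤ)
      (e2 : HD n sub2D (-(4 * (n : ℤ))) ≃+ ℤ),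
      -- the inclusion-induced map H(D^{C₂}) → H(D) is multiplication by 2
      (∀ z : ZD n sub2D (-(4 * (n : ℤ))),
        ∃ hz : (z : V) ∈ ZD n ⊤ (-(4 * (n : ℤ))),
        ef (pD n ⊤ (-(4 * (n : ℤ))) ⟨(z : V), hz⟩) =
          2 * e2 (pD n sub2D (-(4 * (n : ℤ))) z)) ∧
      -- the trace-induced map H(D) → H(D^{C₂}) is an isomorphism
      (∀ z : ZD n ⊤ (-(4 * (n : ℤ))),
        ∃ hz : ((z : V) + gamD2 (z : V)) ∈ ZD n sub2D (-(4 * (n : ℤ))),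
        e2 (pD n sub2D (-(4 * (n : ℤ))) ⟨(z : V) + gamD2 (z : V), hz⟩) =
          ef (pD n ⊤ (-(4 * (n : ℤ))) z)) := by
  have hZ := mem_Z n hn
  have hB := mem_B n hn hodd
  refine ⟨?_, ?_, ?_, ?_, ?_⟩
  · obtain ⟨e, -⟩ := mkEquiv n constsD (-(4 * (n : ℤ)))
      ((Int.castAddHom (ZMod 2)).comp (ev 0)) (by
        intro a
        obtain ⟨k, rfl⟩ := ZMod.intCast_surjective a
        refine ⟨vec k k k k, ?_, ?_⟩
        · rw [hZ, mem_consts]; simp [vec0, vec1, vec2, vec3]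
        · simp [ev_apply, vec0]) (by
        intro f hf
        rw [hZ, mem_consts] at hf
        obtain ⟨h1, h2, h3, h4⟩ := hf
        rw [hB]
        have : ((Int.castAddHom (ZMod 2)).comp (ev 0)) f = ((f 0 : ℤ) : ZMod 2) := rfl
        rw [this, ZMod.intCast_zmod_eq_zero_iff_dvd]
        constructor
        · rintro ⟨g, hg, rfl⟩
          rw [mem_consts] at hg
          refine ⟨g 0, ?_⟩
          simp only [Pi.add_apply, gam0]
          push_cast; linarith [hg.1]
        · rintro ⟨k, hk⟩
          refine ⟨vec k k k k, ?_, ?_⟩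
          · rw [mem_consts]; simp [vec0, vec1, vec2, vec3]
          · rw [ext4]
            simp only [Pi.add_apply, gam0, gam1, gam2, gam3, vec0, vec1, vec2, vec3]
            push_cast at hk
            refine ⟨?_, ?_, ?_, ?_⟩ <;> linarith)
    exact ⟨e⟩
  · intro z
    refine ⟨(hZ _ _).2 trivial, ?_⟩
    rw [eq_neg_iff_add_eq_zero, ← map_add]
    apply pD_eq_zero
    rw [hB]
    exact ⟨z, trivial, add_comm _ _⟩
  · intro z
    have hz := z.2
    rw [hZ, mem_consts] at hz
    refine ⟨(hZ _ _).2 ((mem_sub2 _).2 (by grind)), ?_⟩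
    apply pD_eq_zero
    rw [hB]
    refine ⟨vec ((z : V) 0) 0 ((z : V) 0) 0, ?_, ?_⟩
    · rw [mem_sub2]; simp [vec0, vec1, vec2, vec3]
    · rw [ext4]
      simp only [Pi.add_apply, gam0, gam1, gam2, gam3, vec0, vec1, vec2, vec3]
      refine ⟨?_, ?_, ?_, ?_⟩ <;> linarith
  · intro y
    obtain ⟨z, rfl⟩ := QuotientAddGroup.mk'_surjective _ y
    have hz := z.2
    rw [hZ, mem_consts] at hz
    have key : vec ((z : V) 0) 0 ((z : V) 0) 0 + gamD (vec ((z : V) 0) 0 ((z : V) 0) 0)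
        = (z : V) := by
      rw [ext4]
      simp only [Pi.add_apply, gam0, gam1, gam2, gam3, vec0, vec1, vec2, vec3]
      refine ⟨?_, ?_, ?_, ?_⟩ <;> linarith
    refine ⟨⟨vec ((z : V) 0) 0 ((z : V) 0) 0, ?_⟩, ?_, ?_⟩
    · rw [hZ, mem_sub2]; simp [vec0, vec1, vec2, vec3]
    · rw [key]; exact z.2
    · exact congrArg (pD n constsD _) (Subtype.ext key)
  · obtain ⟨ef, hef⟩ := mkEquiv n ⊤ (-(4 * (n : ℤ)))
      (ev 0 - ev 1 + ev 2 - ev 3) (by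
        intro a
        refine ⟨vec a 0 0 0, (hZ _ _).2 trivial, ?_⟩
        simp [ev_apply, vec0, vec1, vec2, vec3]) (by
        intro f hf
        rw [hB]
        simp only [AddMonoidHom.sub_apply, AddMonoidHom.add_apply, ev_apply]
        constructor
        · rintro ⟨g, -, rfl⟩
          simp only [Pi.add_apply, gam0, gam1, gam2, gam3]
          ring
        · intro h
          refine ⟨vec 0 (f 0) (f 1 - f 0) (f 3), trivial, ?_⟩
          rw [ext4]
          simp only [Pi.add_apply, gam0, gam1, gam2, gam3, vec0, vec1, vec2, vec3]
          refine ⟨?_, ?_, ?_, ?_⟩ <;> linarith)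
    obtain ⟨e2, he2⟩ := mkEquiv n sub2D (-(4 * (n : ℤ)))
      (ev 0 - ev 1) (by
        intro a
        refine ⟨vec a 0 a 0, ?_, ?_⟩
        · rw [hZ, mem_sub2]; simp [vec0, vec1, vec2, vec3]
        · simp [ev_apply, vec0, vec1]) (by
        intro f hf
        rw [hZ, mem_sub2] at hf
        rw [hB]
        simp only [AddMonoidHom.sub_apply, ev_apply]
        constructor
        · rintro ⟨g, hg, rfl⟩
          rw [mem_sub2] at hg
          simp only [Pi.add_apply, gam0, gam1]
          linarith [hg.1]
        · intro h
          refine ⟨vec (f 0) 0 (f 0) 0, ?_, ?_⟩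
          · rw [mem_sub2]; simp [vec0, vec1, vec2, vec3]
          · rw [ext4]
            simp only [Pi.add_apply, gam0, gam1, gam2, gam3, vec0, vec1, vec2, vec3]
            refine ⟨?_, ?_, ?_, ?_⟩ <;> linarith [hf.1, hf.2])
    refine ⟨ef, e2, ?_, ?_⟩
    · intro z
      refine ⟨(hZ _ _).2 trivial, ?_⟩
      have hz := z.2
      rw [hZ, mem_sub2] at hz
      rw [hef, he2]
      simp only [AddMonoidHom.sub_apply, AddMonoidHom.add_apply, ev_apply]
      linarith [hz.1, hz.2]
    · intro z
      refine ⟨?_, ?_⟩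
      · rw [hZ, mem_sub2]
        simp only [Pi.add_apply, gamm0, gamm1, gamm2, gamm3]
        constructor <;> ring
      · rw [hef, he2]
        simp only [AddMonoidHom.sub_apply, AddMonoidHom.add_apply, ev_apply, Pi.add_apply,
          gamm0, gamm1]
        ring

end Stmt7
end

section
/- Let 𝒞 be a pretriangulated category with shift functor Σ. Suppose given nine objects A_{i,j} (0 ≤ i, j ≤ 2) and morphisms a_{i,0} : A_{i,0} → A_{i,1}, a_{i,1} : A_{i,1} → A_{i,2}, a_{i,2} : A_{i,2} → ΣA_{i,0}, b_{0,j} : A_{0,j} → A_{1,j}, b_{1,j} : A_{1,j} → A_{2,j}, b_{2,j} : A_{2,j} → ΣA_{0,j}, such that each row (A_{i,0}, A_{i,1}, A_{i,2}; a_{i,0}, a_{i,1}, a_{i,2}) and each column (A_{0,j}, A_{1,j}, A_{2,j}; b_{0,j}, b_{1,j}, b_{2,j}) is a distinguished triangle, and every square of the resulting diagram (including those formed with the shifted maps Σa_{i,j} and Σb_{i,j}) commutes up to sign, i.e. for each square one composite equals plus or minus the other. Let W be an object and f₃ : W → ΣA_{0,0} a morphism. Then there exists f₁ : W → A_{2,1}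 with b_{2,1} ∘ f₁ = ±(Σa_{0,0}) ∘ f₃ if and only if there exists f₂ : W → A_{1,2} with a_{1,2} ∘ f₂ = ±(Σb_{0,0}) ∘ f₃. Moreover, when such a map exists, (Σc_{0,0}) ∘ f₃ = 0, where c_{0,0} := b_{0,1} ∘ a_{0,0} : A_{0,0} → A_{1,1}. -/
/-!
Statement 8: a formal observation in a pretriangulated category. Given a
3×3 diagram of objects `A_{i,j}` whose rows and columns are distinguished
triangles and all of whose squares (including those involving the shifted
maps) commute up to sign, and a map `f₃ : W ⟶ ΣA₀₀`, a lift `f₁` of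
`±(Σa₀₀) ∘ f₃` through `b₂₁` exists iff a lift `f₂` of `±(Σb₀₀) ∘ f₃`
through `a₁₂` exists; and when such a lift exists, `(Σc₀₀) ∘ f₃ = 0`
where `c₀₀ = b₀₁ ∘ a₀₀`.
-/

open CategoryTheory CategoryTheory.Limits CategoryTheory.Pretriangulated

theorem statement8 {C : Type*} [Category C] [Preadditive C] [HasZeroObject C]
    [HasShift C ℤ] [∀ n : ℤ, (shiftFunctor C n).Additive] [Pretriangulated C]
    {A00 A01 A02 A10 A11 A12 A20 A21 A22 : C}
    (a00 : A00 ⟶ A01) (a01 : A01 ⟶ A02) (a02 : A02 ⟶ A00⟦(1 : ℤ)⟧)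
    (a10 : A10 ⟶ A11) (a11 : A11 ⟶ A12) (a12 : A12 ⟶ A10⟦(1 : ℤ)⟧)
    (a20 : A20 ⟶ A21) (a21 : A21 ⟶ A22) (a22 : A22 ⟶ A20⟦(1 : ℤ)⟧)
    (b00 : A00 ⟶ A10) (b10 : A10 ⟶ A20) (b20 : A20 ⟶ A00⟦(1 : ℤ)⟧)
    (b01 : A01 ⟶ A11) (b11 : A11 ⟶ A21) (b21 : A21 ⟶ A01⟦(1 : ℤ)⟧)
    (b02 : A02 ⟶ A12) (b12 : A12 ⟶ A22) (b22 : A22 ⟶ A02⟦(1 : ℤ)⟧)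
    -- each row is a distinguished triangle
    (hrow0 : Triangle.mk a00 a01 a02 ∈ distTriang C)
    (hrow1 : Triangle.mk a10 a11 a12 ∈ distTriang C)
    (hrow2 : Triangle.mk a20 a21 a22 ∈ distTriang C)
    -- each column is a distinguished triangle
    (hcol0 : Triangle.mk b00 b10 b20 ∈ distTriang C)
    (hcol1 : Triangle.mk b01 b11 b21 ∈ distTriang C)
    (hcol2 : Triangle.mk b02 b12 b22 ∈ distTriang C)
    -- every square of the diagram commutes up to sign
    (sq00 : a00 ≫ b01 = b00 ≫ a10 ∨ a00 ≫ b01 = -(b00 ≫ a10))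
    (sq01 : a01 ≫ b02 = b01 ≫ a11 ∨ a01 ≫ b02 = -(b01 ≫ a11))
    (sq02 : a02 ≫ b00⟦(1 : ℤ)⟧' = b02 ≫ a12 ∨
      a02 ≫ b00⟦(1 : ℤ)⟧' = -(b02 ≫ a12))
    (sq10 : a10 ≫ b11 = b10 ≫ a20 ∨ a10 ≫ b11 = -(b10 ≫ a20))
    (sq11 : a11 ≫ b12 = b11 ≫ a21 ∨ a11 ≫ b12 = -(b11 ≫ a21))
    (sq12 : a12 ≫ b10⟦(1 : ℤ)⟧' = b12 ≫ a22 ∨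
      a12 ≫ b10⟦(1 : ℤ)⟧' = -(b12 ≫ a22))
    (sq20 : a20 ≫ b21 = b20 ≫ a00⟦(1 : ℤ)⟧' ∨
      a20 ≫ b21 = -(b20 ≫ a00⟦(1 : ℤ)⟧'))
    (sq21 : a21 ≫ b22 = b21 ≫ a01⟦(1 : ℤ)⟧' ∨
      a21 ≫ b22 = -(b21 ≫ a01⟦(1 : ℤ)⟧'))
    (sq22 : a22 ≫ b20⟦(1 : ℤ)⟧' = b22 ≫ a02⟦(1 : ℤ)⟧' ∨
      a22 ≫ b20⟦(1 : ℤ)⟧' = -(b22 ≫ a02⟦(1 : ℤ)⟧'))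
    (W : C) (f3 : W ⟶ A00⟦(1 : ℤ)⟧) :
    ((∃ f1 : W ⟶ A21,
        f1 ≫ b21 = f3 ≫ a00⟦(1 : ℤ)⟧' ∨ f1 ≫ b21 = -(f3 ≫ a00⟦(1 : ℤ)⟧')) ↔
      (∃ f2 : W ⟶ A12,
        f2 ≫ a12 = f3 ≫ b00⟦(1 : ℤ)⟧' ∨ f2 ≫ a12 = -(f3 ≫ b00⟦(1 : ℤ)⟧'))) ∧
    ((∃ f1 : W ⟶ A21,
        f1 ≫ b21 = f3 ≫ a00⟦(1 : ℤ)⟧' ∨ f1 ≫ b21 = -(f3 ≫ a00⟦(1 : ℤ)⟧')) →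
      f3 ≫ (a00 ≫ b01)⟦(1 : ℤ)⟧' = 0) := by
  have key : ∀ {X Y Z : C} (u : X ⟶ Y) (v : Y ⟶ Z) (w : Z ⟶ X⟦(1 : ℤ)⟧)
      (_ : Triangle.mk u v w ∈ distTriang C) (g : W ⟶ X⟦(1 : ℤ)⟧),
      (∃ f : W ⟶ Z, f ≫ w = g ∨ f ≫ w = -g) ↔ g ≫ u⟦(1 : ℤ)⟧' = 0 := by
    intro X Y Z u v w h g
    have h0 : w ≫ u⟦(1 : ℤ)⟧' = 0 := comp_distTriang_mor_zero₃₁ _ h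
    constructor
    · rintro ⟨f, hf | hf⟩
      · rw [← hf, Category.assoc, h0, comp_zero]
      · have hg : g = -(f ≫ w) := by rw [hf, neg_neg]
        rw [hg, Preadditive.neg_comp, Category.assoc, h0, comp_zero, neg_zero]
    · intro hg
      obtain ⟨f, hf⟩ := Triangle.coyoneda_exact₁ _ h g hg
      exact ⟨f, Or.inl hf.symm⟩
  rw [key _ _ _ hcol1, key _ _ _ hrow1]
  have e1 : (f3 ≫ a00⟦(1 : ℤ)⟧') ≫ b01⟦(1 : ℤ)⟧' = f3 ≫ (a00 ≫ b01)⟦(1 : ℤ)⟧' := by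
    rw [Functor.map_comp, Category.assoc]
  have e2 : (f3 ≫ b00⟦(1 : ℤ)⟧') ≫ a10⟦(1 : ℤ)⟧' = f3 ≫ (b00 ≫ a10)⟦(1 : ℤ)⟧' := by
    rw [Functor.map_comp, Category.assoc]
  rw [e1, e2]
  refine ⟨?_, id⟩
  rcases sq00 with h | h
  · rw [h]
  · rw [h, Functor.map_neg, Preadditive.comp_neg, neg_eq_zero]
end

section
/- Let G = C_{2^n} with generator γ (n ≥ 2), and let H = C_{2^j} ⊆ K = C_{2^k} be subgroups with 0 ≤ j < k < n. Let E be the chain complex of ℤ[G]-modules concentrated in degrees 0, 1, 2 with E₂ = ℤ[G/K], E₁ = ℤ[G/K] ⊕ ℤ[G/H], E₀ = ℤ ⊕ ℤ[G/H], and differentials ∂₂(z) = ((1−γ)z, Δ(z)) and ∂₁(z, w) = (∇(z), −Δ(z) + (1−γ)w), where ∇ : ℤ[G/K] → ℤ is the augmentation and Δ : ℤ[G/K] → ℤ[G/H] sends a coset gK to the sum of the cosets g'H contained in gK. Then for every subgroup L of G, the L-fixed-point subcomplex E^L has H₀(E^L) ≅ ℤ and H₁(E^L) = H₂(E^L) =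 0. -/
/-!
Statement 11: for `G = C_{2^n}` (n ≥ 2) with subgroups
`H = C_{2^j} ⊆ K = C_{2^k}` (0 ≤ j < k < n), the chain complex `E` (the
cellular chain complex of the virtual representation sphere
`S^{λ_k − λ_j}`) with `E₂ = ℤ[G/K]`, `E₁ = ℤ[G/K] ⊕ ℤ[G/H]`,
`E₀ = ℤ ⊕ ℤ[G/H]`, `∂₂ z = ((1−γ)z, Δz)` and
`∂₁ (z, w) = (∇z, −Δz + (1−γ)w)` has, for every subgroup `L ≤ G`,
`H₀(E^L) ≅ ℤ` and `H₁(E^L) = H₂(E^L) = 0`.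

We realize `ℤ[G/K]` as functions `ZMod (2^(n-k)) → ℤ` (so that the
generator `γ` acts by the shift by `1`), and similarly `ℤ[G/H]` as
`ZMod (2^(n-j)) → ℤ`.  The map `Δ` sends a coset `gK` to the sum of the
cosets `g'H ⊆ gK`, i.e. `(Δf)(c') = f(π c')` for the natural projection
`π : ZMod (2^(n-j)) → ZMod (2^(n-k))`, and `∇` is the augmentation.  The
subgroups of `G` are the `L = C_{2^ℓ}` for `0 ≤ ℓ ≤ n`, generated by
`γ^{2^(n-ℓ)}`; the `L`-fixed submodule is the kernel of
`(shift by 2^(n-ℓ)) − id`.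
-/

namespace Stmt11

instance (m : ℕ) : NeZero ((2 : ℕ) ^ m) := ⟨pow_ne_zero _ (by norm_num)⟩

/-- the shift by `t` of functions `ZMod m → ℤ` (the action of the group
element `γ^t` on the permutation module `ℤ[G/K] ≅ (ZMod m → ℤ)`) -/
def shiftBy (m : ℕ) (t : ZMod m) : (ZMod m → ℤ) →ₗ[ℤ] (ZMod m → ℤ) where
  toFun f := fun c => f (c - t)
  map_add' _ _ := rfl
  map_smul' _ _ := rfl

/-- the augmentation `∇ : ℤ[G/K] → ℤ` -/
noncomputable def aug (m : ℕ) [NeZero m] : (ZMod m → ℤ) →ₗ[ℤ] ℤ where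
  toFun f := ∑ c, f c
  map_add' f g := by simp [Finset.sum_add_distrib]
  map_smul' r f := by simp [Finset.mul_sum]

/-- `Δ : ℤ[G/K] → ℤ[G/H]`, sending a coset `gK` to the sum of the cosets
`g'H` contained in it -/
def delta (n j k : ℕ) (hjk : j ≤ k) :
    (ZMod (2 ^ (n - k)) → ℤ) →ₗ[ℤ] (ZMod (2 ^ (n - j)) → ℤ) where
  toFun f := fun c =>
    f (ZMod.castHom (pow_dvd_pow 2 (Nat.sub_le_sub_left hjk n))
        (ZMod (2 ^ (n - k))) c)
  map_add' _ _ := rfl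
  map_smul' _ _ := rfl

/-- `∂₂ : E₂ → E₁`, `z ↦ ((1−γ)z, Δz)` -/
noncomputable def d2 (n j k : ℕ) (hjk : j ≤ k) :
    (ZMod (2 ^ (n - k)) → ℤ) →ₗ[ℤ]
      ((ZMod (2 ^ (n - k)) → ℤ) × (ZMod (2 ^ (n - j)) → ℤ)) :=
  LinearMap.prod (LinearMap.id - shiftBy (2 ^ (n - k)) 1) (delta n j k hjk)

/-- `∂₁ : E₁ → E₀`, `(z, w) ↦ (∇z, −Δz + (1−γ)w)` -/
noncomputable def d1 (n j k : ℕ) (hjk : j ≤ k) :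
    ((ZMod (2 ^ (n - k)) → ℤ) × (ZMod (2 ^ (n - j)) → ℤ)) →ₗ[ℤ]
      (ℤ × (ZMod (2 ^ (n - j)) → ℤ)) :=
  LinearMap.prod
    (aug (2 ^ (n - k)) ∘ₗ LinearMap.fst ℤ _ _)
    ((-(delta n j k hjk)) ∘ₗ LinearMap.fst ℤ _ _ +
      (LinearMap.id - shiftBy (2 ^ (n - j)) 1) ∘ₗ LinearMap.snd ℤ _ _)

/-- the `L`-fixed subgroup of `E₂ = ℤ[G/K]`, for `L = C_{2^ℓ}` generated by
`γ^{2^(n-ℓ)}` -/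
def F2 (n j k ℓ : ℕ) : AddSubgroup (ZMod (2 ^ (n - k)) → ℤ) :=
  (LinearMap.ker (shiftBy (2 ^ (n - k)) ((2 ^ (n - ℓ) : ℕ) : ZMod (2 ^ (n - k))) -
    LinearMap.id)).toAddSubgroup

/-- the `L`-fixed subgroup of `E₁ = ℤ[G/K] ⊕ ℤ[G/H]` -/
def F1 (n j k ℓ : ℕ) :
    AddSubgroup ((ZMod (2 ^ (n - k)) → ℤ) × (ZMod (2 ^ (n - j)) → ℤ)) :=
  (LinearMap.ker (LinearMap.prodMap
    (shiftBy (2 ^ (n - k)) ((2 ^ (n - ℓ) : ℕ) : ZMod (2 ^ (n - k))) - LinearMap.id)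
    (shiftBy (2 ^ (n - j)) ((2 ^ (n - ℓ) : ℕ) : ZMod (2 ^ (n - j))) -
      LinearMap.id))).toAddSubgroup

/-- the `L`-fixed subgroup of `E₀ = ℤ ⊕ ℤ[G/H]` (the group acts trivially
on the first factor) -/
def F0 (n j k ℓ : ℕ) : AddSubgroup (ℤ × (ZMod (2 ^ (n - j)) → ℤ)) :=
  (LinearMap.ker (LinearMap.prodMap (0 : ℤ →ₗ[ℤ] ℤ)
    (shiftBy (2 ^ (n - j)) ((2 ^ (n - ℓ) : ℕ) : ZMod (2 ^ (n - j))) -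
      LinearMap.id))).toAddSubgroup

/-- boundaries in degree 0 of `E^L` -/
noncomputable def B0 (n j k : ℕ) (hjk : j ≤ k) (ℓ : ℕ) :
    AddSubgroup (ℤ × (ZMod (2 ^ (n - j)) → ℤ)) :=
  (F1 n j k ℓ).map (d1 n j k hjk).toAddMonoidHom

/-- `H₀(E^L)` -/
noncomputable abbrev H0 (n j k : ℕ) (hjk : j ≤ k) (ℓ : ℕ) :=
  F0 n j k ℓ ⧸ (B0 n j k hjk ℓ).addSubgroupOf (F0 n j k ℓ)

/-- cycles in degree 1 of `E^L` -/
noncomputable def Z1 (n j k : ℕ) (hjk : j ≤ k) (ℓ : ℕ) :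
    AddSubgroup ((ZMod (2 ^ (n - k)) → ℤ) × (ZMod (2 ^ (n - j)) → ℤ)) :=
  F1 n j k ℓ ⊓ (LinearMap.ker (d1 n j k hjk)).toAddSubgroup

/-- boundaries in degree 1 of `E^L` -/
noncomputable def B1 (n j k : ℕ) (hjk : j ≤ k) (ℓ : ℕ) :
    AddSubgroup ((ZMod (2 ^ (n - k)) → ℤ) × (ZMod (2 ^ (n - j)) → ℤ)) :=
  (F2 n j k ℓ).map (d2 n j k hjk).toAddMonoidHom

/-- `H₁(E^L)` -/
noncomputable abbrev H1 (n j k : ℕ) (hjk : j ≤ k) (ℓ : ℕ) :=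
  Z1 n j k hjk ℓ ⧸ (B1 n j k hjk ℓ).addSubgroupOf (Z1 n j k hjk ℓ)

/-- cycles in degree 2 of `E^L`; since there are no 3-chains this is
`H₂(E^L)` -/
noncomputable def Z2 (n j k : ℕ) (hjk : j ≤ k) (ℓ : ℕ) :
    AddSubgroup (ZMod (2 ^ (n - k)) → ℤ) :=
  F2 n j k ℓ ⊓ (LinearMap.ker (d2 n j k hjk)).toAddSubgroup

open Function

lemma mem_F2 (n j k ℓ : ℕ) (z : ZMod (2 ^ (n - k)) → ℤ) :
    z ∈ F2 n j k ℓ ↔ Periodic z ((2 ^ (n - ℓ) : ℕ) : ZMod (2 ^ (n - k))) := by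
  have : z ∈ F2 n j k ℓ ↔ ∀ x, z (x - ((2 ^ (n - ℓ) : ℕ) : ZMod (2 ^ (n - k)))) = z x := by
    simp only [F2, Submodule.mem_toAddSubgroup, LinearMap.mem_ker, LinearMap.sub_apply,
      sub_eq_zero, funext_iff]
    rfl
  rw [this]
  constructor
  · intro h x
    have := h (x + ((2 ^ (n - ℓ) : ℕ) : ZMod (2 ^ (n - k))))
    rw [add_sub_cancel_right] at this
    exact this.symm
  · intro h x
    exact h.sub_eq x

lemma mem_F1 (n j k ℓ : ℕ) (x : (ZMod (2 ^ (n - k)) → ℤ) × (ZMod (2 ^ (n - j)) → ℤ)) :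
    x ∈ F1 n j k ℓ ↔ Periodic x.1 ((2 ^ (n - ℓ) : ℕ) : ZMod (2 ^ (n - k))) ∧
      Periodic x.2 ((2 ^ (n - ℓ) : ℕ) : ZMod (2 ^ (n - j))) := by
  rw [← mem_F2 n j k ℓ, ← mem_F2 n j j ℓ]
  simp only [F1, F2, Submodule.mem_toAddSubgroup, LinearMap.mem_ker, LinearMap.prodMap_apply,
    Prod.mk_eq_zero]

lemma mem_F0 (n j k ℓ : ℕ) (x : ℤ × (ZMod (2 ^ (n - j)) → ℤ)) :
    x ∈ F0 n j k ℓ ↔ Periodic x.2 ((2 ^ (n - ℓ) : ℕ) : ZMod (2 ^ (n - j))) := by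
  rw [← mem_F2 n j j ℓ]
  simp only [F0, F2, Submodule.mem_toAddSubgroup, LinearMap.mem_ker, LinearMap.prodMap_apply,
    Prod.mk_eq_zero, LinearMap.zero_apply, true_and]

lemma desc (g : ℕ → ℤ) (N : ℕ) (hg : Periodic g N) (i : ℕ) :
    g ((i : ZMod N).val) = g i := by
  rw [ZMod.val_natCast, hg.map_mod_nat]

lemma desc_periodic (g : ℕ → ℤ) (N p : ℕ) [NeZero N] (hN : Periodic g N) (hp : Periodic g p) :
    Periodic (fun x : ZMod N => g x.val) (p : ZMod N) := by
  intro x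
  obtain ⟨i, rfl⟩ := ZMod.natCast_zmod_surjective x
  show g _ = g _
  rw [← Nat.cast_add, desc g N hN, desc g N hN, hp]

lemma per_nat {N p : ℕ} {f : ZMod N → ℤ} (h : Periodic f (p : ZMod N)) :
    Periodic (fun i : ℕ => f (i : ZMod N)) p := by
  intro i
  show f _ = f _
  rw [Nat.cast_add, h]

lemma per_dvd {p q : ℕ} {g : ℕ → ℤ} (h : Periodic g p) (hd : p ∣ q) : Periodic g q := by
  obtain ⟨r, rfl⟩ := hd
  have := h.nat_mul r
  rw [mul_comm]
  exact this

lemma per_dvd' {N p q : ℕ} {f : ZMod N → ℤ} (h : Periodic f (p : ZMod N)) (hd : p ∣ q) :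
    Periodic f (q : ZMod N) := by
  obtain ⟨r, rfl⟩ := hd
  have := h.nat_mul r
  rw [mul_comm]
  push_cast
  exact this

lemma sum_window {g : ℕ → ℤ} {p : ℕ} (h : Periodic g p) (q : ℕ) :
    ∑ i ∈ Finset.range p, g (q + i) = ∑ i ∈ Finset.range p, g i := by
  induction q with
  | zero => simp
  | succ q ih =>
    rw [← ih]
    have h1 := Finset.sum_range_succ (fun i => g (q + i)) p
    have h2 := Finset.sum_range_succ' (fun i => g (q + i)) p
    have h3 : g (q + p) = g q := h q
    have h4 : ∑ i ∈ Finset.range p, g (q + 1 + i) = ∑ i ∈ Finset.range p, g (q + (i + 1)) :=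
      Finset.sum_congr rfl (fun i _ => by congr 1; ring)
    rw [h4]
    simp only [add_zero] at h2
    linarith

lemma sum_mul_per {g : ℕ → ℤ} {p : ℕ} (h : Periodic g p) (r : ℕ) :
    ∑ i ∈ Finset.range (p * r), g i = r * ∑ i ∈ Finset.range p, g i := by
  induction r with
  | zero => simp
  | succ r ih =>
    rw [mul_add, mul_one, Finset.sum_range_add, ih, sum_window h]
    push_cast
    ring

lemma aug_eq (m : ℕ) [NeZero m] (z : ZMod m → ℤ) :
    aug m z = ∑ i ∈ Finset.range m, z (i : ZMod m) := by
  show ∑ c, z c = _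
  refine Finset.sum_bij' (fun c _ => c.val) (fun i _ => (i : ZMod m)) ?_ ?_ ?_ ?_ ?_
  · intro c _
    exact Finset.mem_range.2 (ZMod.val_lt c)
  · simp
  · intro c _
    simp
  · intro i hi
    exact ZMod.val_cast_of_lt (Finset.mem_range.1 hi)
  · intro c _
    simp

/-- sum over the first `p` residues -/
def psi (N p : ℕ) : (ZMod N → ℤ) →+ ℤ where
  toFun f := ∑ i ∈ Finset.range p, f (i : ZMod N)
  map_zero' := by simp
  map_add' f g := by simp [Finset.sum_add_distrib]

lemma psi_apply (N p : ℕ) (f : ZMod N → ℤ) :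
    psi N p f = ∑ i ∈ Finset.range p, f (i : ZMod N) := rfl

lemma psi_diff (N p : ℕ) (w : ZMod N → ℤ) (h : Periodic w (p : ZMod N)) :
    psi N p (fun x => w x - w (x - 1)) = 0 := by
  rw [psi_apply]
  have := Finset.sum_range_sub (fun i : ℕ => w ((i : ZMod N) - 1)) p
  have h2 : w ((p : ZMod N) - 1) = w (((0 : ℕ) : ZMod N) - 1) := by
    rw [← h (((0 : ℕ) : ZMod N) - 1)]
    congr 1
    push_cast
    ring
  rw [h2, sub_self] at this
  rw [← this]
  refine Finset.sum_congr rfl (fun i _ => ?_)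
  push_cast
  rw [add_sub_cancel_right]

lemma exists_prim (N p : ℕ) [NeZero N] (hpN : p ∣ N) (f : ZMod N → ℤ)
    (h : Periodic f (p : ZMod N)) (h0 : psi N p f = 0) :
    ∃ w : ZMod N → ℤ, Periodic w (p : ZMod N) ∧ ∀ x, w x - w (x - 1) = f x := by
  have hf := per_nat h
  rw [psi_apply] at h0
  let g : ℕ → ℤ := fun q => ∑ i ∈ Finset.range (q + 1), f (i : ZMod N)
  have hg : Periodic g p := by
    intro q
    show ∑ i ∈ Finset.range (q + p + 1), f (i : ZMod N) =
      ∑ i ∈ Finset.range (q + 1), f (i : ZMod N)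
    rw [show q + p + 1 = (q + 1) + p by ring, Finset.sum_range_add]
    have := sum_window hf (q + 1)
    rw [this, h0, add_zero]
  have hN := per_dvd hg hpN
  refine ⟨fun x => g x.val, desc_periodic g N p hN hg, ?_⟩
  intro x
  obtain ⟨y, rfl⟩ : ∃ y, x = y + 1 := ⟨x - 1, by ring⟩
  obtain ⟨i, rfl⟩ := ZMod.natCast_zmod_surjective y
  rw [add_sub_cancel_right, ← Nat.cast_one, ← Nat.cast_add]
  show g _ - g _ = _
  rw [desc g N hN, desc g N hN]
  show ∑ i ∈ Finset.range (i + 1 + 1), f (i : ZMod N) -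
      ∑ i ∈ Finset.range (i + 1), f (i : ZMod N) = _
  rw [Finset.sum_range_succ, add_sub_cancel_left]

lemma delta_nat (n j k : ℕ) (hjk : j ≤ k) (z : ZMod (2 ^ (n - k)) → ℤ) (i : ℕ) :
    delta n j k hjk z (i : ZMod (2 ^ (n - j))) = z (i : ZMod (2 ^ (n - k))) := by
  show z _ = z _
  rw [map_natCast]

lemma delta_sub_one (n j k : ℕ) (hjk : j ≤ k) (z : ZMod (2 ^ (n - k)) → ℤ)
    (x : ZMod (2 ^ (n - j))) :
    delta n j k hjk z (x - 1) = delta n j k hjk (shiftBy _ 1 z) x := by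
  show z _ = z _
  rw [map_sub, map_one]

lemma d1_fst (n j k : ℕ) (hjk : j ≤ k) (z : ZMod (2 ^ (n - k)) → ℤ)
    (w : ZMod (2 ^ (n - j)) → ℤ) : (d1 n j k hjk (z, w)).1 = aug (2 ^ (n - k)) z := rfl

lemma d1_snd (n j k : ℕ) (hjk : j ≤ k) (z : ZMod (2 ^ (n - k)) → ℤ)
    (w : ZMod (2 ^ (n - j)) → ℤ) : (d1 n j k hjk (z, w)).2 =
      - delta n j k hjk z + fun x => w x - w (x - 1) := rfl

lemma mem_B0 (n j k : ℕ) (hjk : j ≤ k) (ℓ : ℕ) (x : ℤ × (ZMod (2 ^ (n - j)) → ℤ)) :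
    x ∈ B0 n j k hjk ℓ ↔ ∃ z w, Periodic z ((2 ^ (n - ℓ) : ℕ) : ZMod (2 ^ (n - k))) ∧
      Periodic w ((2 ^ (n - ℓ) : ℕ) : ZMod (2 ^ (n - j))) ∧
      aug (2 ^ (n - k)) z = x.1 ∧
      (- delta n j k hjk z + fun x => w x - w (x - 1)) = x.2 := by
  constructor
  · rintro ⟨⟨z, w⟩, h, rfl⟩
    have := (mem_F1 n j k ℓ _).1 h
    exact ⟨z, w, this.1, this.2, rfl, rfl⟩
  · rintro ⟨z, w, h1, h2, h3, h4⟩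
    exact ⟨(z, w), (mem_F1 n j k ℓ _).2 ⟨h1, h2⟩, Prod.ext h3 h4⟩

lemma H0_equiv_of (n j k : ℕ) (hjk : j ≤ k) (ℓ : ℕ)
    (Φ : (ℤ × (ZMod (2 ^ (n - j)) → ℤ)) →+ ℤ)
    (hs : ∀ v, ∃ x ∈ F0 n j k ℓ, Φ x = v)
    (hk : ∀ x ∈ F0 n j k ℓ, Φ x = 0 ↔ x ∈ B0 n j k hjk ℓ) :
    Nonempty (H0 n j k hjk ℓ ≃+ ℤ) := by
  let Ψ : F0 n j k ℓ →+ ℤ := Φ.comp (F0 n j k ℓ).subtype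
  have hsurj : Surjective Ψ := by
    intro v
    obtain ⟨x, hx, h⟩ := hs v
    exact ⟨⟨x, hx⟩, h⟩
  have hker : (B0 n j k hjk ℓ).addSubgroupOf (F0 n j k ℓ) = Ψ.ker := by
    ext ⟨x, hx⟩
    rw [AddSubgroup.mem_addSubgroupOf, AddMonoidHom.mem_ker]
    exact (hk x hx).symm
  exact ⟨(QuotientAddGroup.quotientAddEquivOfEq hker).trans
    (QuotientAddGroup.quotientKerEquivOfSurjective Ψ hsurj)⟩

/-- the linear form `α r + β ψ(f)` -/
def phi (N p : ℕ) (α β : ℤ) : (ℤ × (ZMod N → ℤ)) →+ ℤ where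
  toFun x := α * x.1 + β * psi N p x.2
  map_zero' := by simp
  map_add' x y := by simp; ring

lemma phi_apply (N p : ℕ) (α β : ℤ) (r : ℤ) (f : ZMod N → ℤ) :
    phi N p α β (r, f) = α * r + β * psi N p f := rfl

lemma per_N {N : ℕ} (f : ZMod N → ℤ) : Periodic f (N : ZMod N) := by
  intro x
  simp

lemma psi_delta (n j k : ℕ) (hjk : j ≤ k) (p : ℕ) (z : ZMod (2 ^ (n - k)) → ℤ) :
    psi (2 ^ (n - j)) p (delta n j k hjk z) = psi (2 ^ (n - k)) p z := by
  rw [psi_apply, psi_apply]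
  exact Finset.sum_congr rfl (fun i _ => delta_nat n j k hjk z i)

lemma psi_mul {N p : ℕ} {f : ZMod N → ℤ} (h : Periodic f (p : ZMod N)) (r : ℕ) :
    psi N (p * r) f = r * psi N p f :=
  sum_mul_per (per_nat h) r

lemma H0_case1 (n j k : ℕ) (hjk : j < k) (ℓ : ℕ) (hc : n - ℓ ≤ n - k) :
    Nonempty (H0 n j k hjk.le ℓ ≃+ ℤ) := by
  obtain ⟨r, hr⟩ := pow_dvd_pow 2 hc
  refine H0_equiv_of n j k hjk.le ℓ (phi _ (2 ^ (n - ℓ)) 1 r) ?_ ?_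
  · intro v
    refine ⟨(v, 0), (mem_F0 _ _ _ _ _).2 (fun x => rfl), ?_⟩
    rw [phi_apply, map_zero]
    ring
  · rintro ⟨s, f⟩ hx
    rw [mem_F0] at hx
    simp only at hx
    rw [mem_B0, phi_apply]
    constructor
    · intro h0
      have hf := per_nat hx
      have hm : Periodic (fun i : ℕ => f (i : ZMod (2 ^ (n - j)))) (2 ^ (n - k)) :=
        per_dvd hf (pow_dvd_pow 2 hc)
      have hz := desc_periodic _ (2 ^ (n - k)) _ hm hf
      refine ⟨fun x => - f (x.val : ZMod (2 ^ (n - j))), 0, ?_, fun x => rfl, ?_, ?_⟩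
      · intro x
        exact congrArg Neg.neg (hz x)
      · rw [aug_eq]
        have h1 : ∀ i : ℕ, f (((i : ZMod (2 ^ (n - k))).val : ℕ) : ZMod (2 ^ (n - j))) =
          f (i : ZMod (2 ^ (n - j))) := desc _ _ hm
        simp only [h1, Finset.sum_neg_distrib]
        have h2 := psi_mul hx r
        rw [← hr, psi_apply] at h2
        rw [h2]
        linarith
      · ext x
        obtain ⟨i, rfl⟩ := ZMod.natCast_zmod_surjective x
        simp only [Pi.add_apply, Pi.neg_apply, delta_nat, Pi.zero_apply]
        have h1 : ∀ i : ℕ, f (((i : ZMod (2 ^ (n - k))).val : ℕ) : ZMod (2 ^ (n - j))) =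
          f (i : ZMod (2 ^ (n - j))) := desc _ _ hm
        rw [h1]
        ring
    · rintro ⟨z, w, h1, h2, h3, h4⟩
      simp only at h3 h4
      rw [← h3, ← h4, map_add, map_neg, psi_delta, psi_diff _ _ _ h2, aug_eq]
      have h5 := psi_mul h1 r
      rw [← hr, psi_apply] at h5
      rw [h5]
      ring

lemma H0_case2 (n j k : ℕ) (hjk : j < k) (ℓ : ℕ) (hc : n - k ≤ n - ℓ) :
    Nonempty (H0 n j k hjk.le ℓ ≃+ ℤ) := by
  obtain ⟨p, hp⟩ : ∃ p, p = 2 ^ (min (n - ℓ) (n - j)) := ⟨_, rfl⟩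
  have hpt : p ∣ 2 ^ (n - ℓ) := hp ▸ pow_dvd_pow 2 (min_le_left _ _)
  have hpN : p ∣ 2 ^ (n - j) := hp ▸ pow_dvd_pow 2 (min_le_right _ _)
  have hmp : 2 ^ (n - k) ∣ p := hp ▸ pow_dvd_pow 2 (le_min hc (by omega))
  have hp0 : 0 < p := hp ▸ by positivity
  have hper : ∀ f : ZMod (2 ^ (n - j)) → ℤ,
      Periodic f ((2 ^ (n - ℓ) : ℕ) : ZMod (2 ^ (n - j))) → Periodic f (p : ZMod _) := by
    intro f hf
    rcases le_total (n - ℓ) (n - j) with h | h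
    · rw [hp, min_eq_left h]; exact hf
    · rw [hp, min_eq_right h]; exact per_N f
  obtain ⟨r, hr⟩ := hmp
  have hpsi : ∀ z : ZMod (2 ^ (n - k)) → ℤ,
      psi (2 ^ (n - k)) p z = r * aug (2 ^ (n - k)) z := by
    intro z
    rw [hr, psi_mul (per_N z), aug_eq, psi_apply]
  refine H0_equiv_of n j k hjk.le ℓ (phi _ p r 1) ?_ ?_
  · intro v
    have hg : Periodic (fun i : ℕ => if p ∣ i then v else 0) p := by
      intro i
      simp
    refine ⟨(0, fun x => if p ∣ x.val then v else 0), (mem_F0 _ _ _ _ _).2 ?_, ?_⟩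
    · exact desc_periodic _ _ _ (per_dvd hg hpN) (per_dvd hg hpt)
    · rw [phi_apply, psi_apply]
      have h1 : ∀ i : ℕ, (if p ∣ (i : ZMod (2 ^ (n - j))).val then v else 0) =
        if p ∣ i then v else 0 := desc _ _ (per_dvd hg hpN)
      simp only [h1]
      rw [Finset.sum_eq_single 0]
      · simp
      · intro b hb hb0
        rw [if_neg]
        intro hd
        exact absurd (Nat.le_of_dvd (Nat.pos_of_ne_zero hb0) hd)
          (not_le.2 (Finset.mem_range.1 hb))
      · intro h
        exact absurd (Finset.mem_range.2 hp0) h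
  · rintro ⟨s, f⟩ hx
    rw [mem_F0] at hx
    simp only at hx
    rw [mem_B0, phi_apply]
    constructor
    · intro h0
      have haug : aug (2 ^ (n - k)) (Pi.single 0 s) = s := by
        show ∑ c, (Pi.single 0 s : ZMod (2 ^ (n - k)) → ℤ) c = s
        simp
      have hz : ∀ z : ZMod (2 ^ (n - k)) → ℤ,
          Periodic z ((2 ^ (n - ℓ) : ℕ) : ZMod (2 ^ (n - k))) := fun z =>
        per_dvd' (per_N z) (pow_dvd_pow 2 hc)
      have hd : Periodic (delta n j k hjk.le (Pi.single 0 s)) (p : ZMod (2 ^ (n - j))) := by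
        intro x
        obtain ⟨i, rfl⟩ := ZMod.natCast_zmod_surjective x
        rw [← Nat.cast_add, delta_nat, delta_nat, Nat.cast_add]
        exact per_dvd' (per_N _) ⟨r, hr⟩ _
      obtain ⟨w, hw, hw2⟩ := exists_prim (2 ^ (n - j)) p hpN
        (f + delta n j k hjk.le (Pi.single 0 s)) ((hper f hx).add hd) (by
          rw [map_add, psi_delta, hpsi, haug]
          linarith)
      refine ⟨Pi.single 0 s, w, hz _, per_dvd' hw hpt, haug, ?_⟩
      ext x
      simp only [Pi.add_apply, Pi.neg_apply, hw2]
      ring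
    · rintro ⟨z, w, h1, h2, h3, h4⟩
      simp only at h3 h4
      rw [← h3, ← h4, map_add, map_neg, psi_delta, psi_diff _ _ _ (hper _ h2), hpsi]
      ring

lemma delta_inj (n j k : ℕ) (hjk : j ≤ k) : Injective (delta n j k hjk) := by
  intro z z' h
  ext x
  obtain ⟨i, rfl⟩ := ZMod.natCast_zmod_surjective x
  rw [← delta_nat n j k hjk z, h, delta_nat]

lemma H1_zero (n j k : ℕ) (hjk : j ≤ k) (ℓ : ℕ)
    (x : (ZMod (2 ^ (n - k)) → ℤ) × (ZMod (2 ^ (n - j)) → ℤ))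
    (hx : x ∈ Z1 n j k hjk ℓ) : x ∈ B1 n j k hjk ℓ := by
  obtain ⟨z, w⟩ := x
  obtain ⟨hF, hk⟩ := hx
  have hF' := (mem_F1 _ _ _ _ _).1 hF
  obtain ⟨hz, hw⟩ := hF'
  simp only at hz hw
  have hk' : d1 n j k hjk (z, w) = 0 := hk
  have h1 : aug (2 ^ (n - k)) z = 0 := congrArg Prod.fst hk'
  have h2 : (- delta n j k hjk z + fun x => w x - w (x - 1)) = 0 := congrArg Prod.snd hk'
  have h3 : ∀ x, w x - w (x - 1) = delta n j k hjk z x := by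
    intro x
    have := congrFun h2 x
    simp only [Pi.add_apply, Pi.neg_apply, Pi.zero_apply] at this
    linarith
  rw [aug_eq] at h1
  have hwm : Periodic (fun i : ℕ => w (i : ZMod (2 ^ (n - j)))) (2 ^ (n - k)) := by
    intro q
    show w _ = w _
    have ht := Finset.sum_range_sub (fun i : ℕ => w ((q + i : ℕ) : ZMod (2 ^ (n - j))))
      (2 ^ (n - k))
    have hs : ∀ i : ℕ, w ((q + (i + 1) : ℕ) : ZMod (2 ^ (n - j))) -
        w ((q + i : ℕ) : ZMod (2 ^ (n - j))) = z ((q + 1 + i : ℕ) : ZMod (2 ^ (n - k))) := by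
      intro i
      have := h3 ((q + 1 + i : ℕ) : ZMod (2 ^ (n - j)))
      rw [delta_nat] at this
      rw [← this]
      congr 2 <;> congr 1 <;> push_cast <;> ring
    simp only [hs] at ht
    have hwin := sum_window (per_nat (per_N z)) (q + 1)
    rw [hwin, h1, add_zero] at ht
    linarith
  let y : ZMod (2 ^ (n - k)) → ℤ := fun x => w (x.val : ZMod (2 ^ (n - j)))
  have hy : delta n j k hjk y = w := by
    ext x
    obtain ⟨i, rfl⟩ := ZMod.natCast_zmod_surjective x
    rw [delta_nat]
    exact desc _ _ hwm i
  refine ⟨y, (mem_F2 _ _ _ _ _).2 ?_, ?_⟩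
  · exact desc_periodic _ _ _ hwm (per_nat hw)
  · refine Prod.ext ?_ hy
    show y - shiftBy _ 1 y = z
    apply delta_inj n j k hjk
    ext x
    rw [map_sub, Pi.sub_apply, ← delta_sub_one, hy, h3]

/-- For `G = C_{2^n}` (n ≥ 2) and `H = C_{2^j} ⊆ K = C_{2^k}` with
`0 ≤ j < k < n`: for every subgroup `L = C_{2^ℓ}` of `G`, the fixed-point
subcomplex `E^L` has `H₀(E^L) ≅ ℤ` and `H₁(E^L) = H₂(E^L) = 0`. -/
theorem statement11 (n j k : ℕ) (hn : 2 ≤ n) (hjk : j < k) (hkn : k < n) :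
    ∀ ℓ : ℕ, ℓ ≤ n →
      Nonempty (H0 n j k hjk.le ℓ ≃+ ℤ) ∧
      (∀ x : H1 n j k hjk.le ℓ, x = 0) ∧
      (∀ x : Z2 n j k hjk.le ℓ, x = 0) := by
  intro ℓ _
  refine ⟨?_, ?_, ?_⟩
  · rcases le_total (n - ℓ) (n - k) with h | h
    · exact H0_case1 n j k hjk ℓ h
    · exact H0_case2 n j k hjk ℓ h
  · intro x
    induction x using QuotientAddGroup.induction_on with
    | H x =>
      rw [QuotientAddGroup.eq_zero_iff, AddSubgroup.mem_addSubgroupOf]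
      exact H1_zero n j k hjk.le ℓ x.1 x.2
  · rintro ⟨z, hz, hk⟩
    have h1 : d2 n j k hjk.le z = 0 := hk
    have h2 : delta n j k hjk.le z = 0 := congrArg Prod.snd h1
    apply Subtype.ext
    exact delta_inj n j k hjk.le (h2.trans (map_zero _).symm)

end Stmt11
end
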